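/- arXiv:1501.01449 — 2 statements merged into one kernel-verified Lean document; each statement's English description precedes it below -/
import Mathlib

section
/- Let d ≥ 1 and let Ω ⊆ ℝ^d be open, connected and nonempty. Let D ⊆ ℂ be open and preconnected with 0 ∈ D, and let 𝒜 ⊆ D be compact. Let θ : ℂ → (ℝ^d → ℂ) be such that: (i) for every ω ∈ D the function x ↦ θ_ω(x) is real-analytic on Ω; (ii) for every x ∈ Ω the function ω ↦ θ_ω(x) is holomorphic on D; (iii) θ_0(x) ≠ 0 for every x ∈ Ω. Then the set {ω ∈ 𝒜 : there exists a nonempty open set U ⊆ Ω with θ_ω(x) = 0 for all x ∈ U} is finite. -/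
/-- An analytic function on a preconnected set which is nonzero at some point of that set has
only finitely many zeros in each compact subset. -/
theorem AnalyticOnNhd.finite_zeros_of_isCompact {𝕜 E : Type*} [NontriviallyNormedField 𝕜]
    [NormedAddCommGroup E] [NormedSpace 𝕜 E] {f : 𝕜 → E} {D K : Set 𝕜}
    (hf : AnalyticOnNhd 𝕜 f D) (hD : IsPreconnected D) (hKD : K ⊆ D) (hK : IsCompact K)
    {z₀ : 𝕜} (hz₀ : z₀ ∈ D) (hfz₀ : f z₀ ≠ 0) : {z ∈ K | f z = 0}.Finite := by
  by_contra hinf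
  obtain ⟨z, hz, hacc⟩ :=
    Set.Infinite.exists_accPt_of_subset_isCompact hinf hK (Set.sep_subset _ _)
  refine hfz₀ (hf.eqOn_zero_of_preconnected_of_frequently_eq_zero hD (hKD hz) ?_ hz₀)
  exact (accPt_iff_frequently_nhdsNE.mp hacc).mono fun _ h => h.2

/-- The top-dimensional case of Lemma 2.4 (with `X = Ω`): under the analyticity/holomorphy
assumptions on `θ` and the nonvanishing of `θ_0` on the open connected nonempty set `Ω`,
the set of frequencies `ω` in the compact set `𝒜 ⊆ D` for which the zero set
`Z(ω) = {x ∈ Ω : θ_ω(x) = 0}` has nonempty interior (i.e. contains a nonempty open set)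
is finite. -/
theorem stmt_6 (d : ℕ) (hd : 1 ≤ d)
    (Ω : Set (EuclideanSpace ℝ (Fin d)))
    (hΩ : IsOpen Ω) (hΩconn : IsConnected Ω)
    (D : Set ℂ) (hD : IsOpen D) (hDconn : IsPreconnected D) (h0D : (0 : ℂ) ∈ D)
    (𝒜 : Set ℂ) (h𝒜D : 𝒜 ⊆ D) (h𝒜cpt : IsCompact 𝒜)
    (θ : ℂ → EuclideanSpace ℝ (Fin d) → ℂ)
    (hAnal : ∀ ω ∈ D, AnalyticOnNhd ℝ (θ ω) Ω)
    (hHol : ∀ x ∈ Ω, DifferentiableOn ℂ (fun ω => θ ω x) D)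
    (hθ0 : ∀ x ∈ Ω, θ 0 x ≠ 0) :
    {ω ∈ 𝒜 | ∃ U : Set (EuclideanSpace ℝ (Fin d)),
      IsOpen U ∧ U.Nonempty ∧ U ⊆ Ω ∧ ∀ x ∈ U, θ ω x = 0}.Finite := by
  obtain ⟨x₀, hx₀⟩ := hΩconn.nonempty
  refine (((hHol x₀ hx₀).analyticOnNhd hD).finite_zeros_of_isCompact hDconn h𝒜D h𝒜cpt h0D
    (hθ0 x₀ hx₀)).subset ?_
  rintro ω ⟨hω, U, hU, ⟨y, hy⟩, hUΩ, hzero⟩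
  exact ⟨hω, (hAnal ω (h𝒜D hω)).eqOn_zero_of_preconnected_of_eventuallyEq_zero
    hΩconn.isPreconnected (hUΩ hy) (Filter.eventually_of_mem (hU.mem_nhds hy) hzero) hx₀⟩
end

section
/- Let d ≥ 1 and let Ω ⊆ ℝ^d be open. Let Ω'' be an open set with compact closure satisfying closure(Ω'') ⊆ Ω. Let D ⊆ ℂ be open and preconnected with 0 ∈ D, and let 𝒜 ⊆ D be compact. Let θ : ℂ → (ℝ^d → ℂ) be such that: (i) for every ω ∈ D the function x ↦ θ_ω(x) is real-analytic on Ω; (ii) for every x ∈ Ω the function ω ↦ θ_ω(x) is holomorphic on D; (iii) θ_0(x) ≠ 0 for every x ∈ Ω. Let g_1, …, g_N : ℝ^d → ℂ be real-analytic on Ω and set X = {x ∈ Ω : g_1(x) = ⋯ = g_N(x) = 0}; assume X ∩ Ω'' ≠ ∅. For ω ∈ D set Z(ω) = {x ∈ Ω : θ_ω(x) = 0}. Then the set {ω ∈ 𝒜 : Z(ω) ∩ X ∩ Ω'' ≠ ∅ and dimH(Z(ω) ∩ X ∩ Ω'') = dimH(X ∩ Ω'')} is finite, where dimH denotes Hausdorff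 dimension. -/
open Set Filter Topology

theorem exists_banachAlgebra_extension {d : ℕ} {f : (Fin d → ℝ) → ℝ} (hf : AnalyticAt ℝ f 0) :
    ∃ ρ : ℝ, 0 < ρ ∧ ∀ (A : Type) [NormedCommRing A] [NormedAlgebra ℝ A] [CompleteSpace A]
      [NormOneClass A], ∃ F : (Fin d → A) → A, AnalyticOnNhd ℝ F (Metric.ball 0 ρ) ∧
        ∀ χ : A →ₐ[ℝ] ℝ, (∀ a, ‖χ a‖ ≤ ‖a‖) → ∀ v ∈ Metric.ball (0 : Fin d → A) ρ,
          χ (F v) = f (fun i => χ (v i)) := by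
  obtain ⟨p, r, hp⟩ := hf
  obtain ⟨r₀, hr₀, hr₀r⟩ := ENNReal.lt_iff_exists_nnreal_btwn.1 hp.r_pos
  have hr₀' : 0 < r₀ := by exact_mod_cast hr₀
  obtain ⟨C, hC, hpC⟩ := p.norm_mul_pow_le_of_lt_radius (hr₀r.trans_le hp.r_le)
  set ρ : NNReal := r₀ / (d + 1) with hρ
  have hρpos : 0 < ρ := by positivity
  have hρr : ρ ≤ r₀ := div_le_self (zero_le) (by simp)
  refine ⟨ρ, hρpos, fun A _ _ _ _ => ?_⟩
  let e : Fin d → Fin d → ℝ := fun i => Pi.single i 1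
  let P : FormalMultilinearSeries ℝ (Fin d → A) A := fun n =>
    ∑ σ : Fin n → Fin d, p n (fun i => e (σ i)) •
      (ContinuousMultilinearMap.mkPiAlgebra ℝ (Fin n) A).compContinuousLinearMap
        (fun i => ContinuousLinearMap.proj (R := ℝ) (φ := fun _ : Fin d => A) (σ i))
  have hPn : ∀ n, ‖P n‖ ≤ (d : ℝ) ^ n * ‖p n‖ := by
    intro n
    refine (norm_sum_le _ _).trans ((Finset.sum_le_card_nsmul _ _ ‖p n‖ ?_).trans ?_)
    · intro σ _
      rw [norm_smul]
      have h1 : ‖p n (fun i => e (σ i))‖ ≤ ‖p n‖ := by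
        refine ((p n).le_opNorm _).trans ?_
        simp [e, Pi.norm_single]
      have h2 : ‖(ContinuousMultilinearMap.mkPiAlgebra ℝ (Fin n) A).compContinuousLinearMap
          (fun i => ContinuousLinearMap.proj (R := ℝ) (φ := fun _ : Fin d => A) (σ i))‖ ≤ 1 := by
        refine ContinuousMultilinearMap.opNorm_le_bound zero_le_one fun v => ?_
        simp only [ContinuousMultilinearMap.compContinuousLinearMap_apply,
          ContinuousMultilinearMap.mkPiAlgebra_apply, ContinuousLinearMap.proj_apply, one_mul]
        refine (Finset.norm_prod_le _ _).trans (Finset.prod_le_prod (by simp) fun i _ => ?_)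
        exact norm_le_pi_norm (v i) (σ i)
      calc _ ≤ ‖p n‖ * 1 := mul_le_mul h1 h2 (norm_nonneg _) (norm_nonneg _)
        _ = _ := mul_one _
    · simp
  have hrad : (ρ : ENNReal) ≤ P.radius := by
    refine P.le_radius_of_bound C fun n => ?_
    calc ‖P n‖ * (ρ : ℝ) ^ n ≤ (d : ℝ) ^ n * ‖p n‖ * (ρ : ℝ) ^ n := by
          gcongr; exact hPn n
      _ = ‖p n‖ * (d * ρ : ℝ) ^ n := by ring
      _ ≤ ‖p n‖ * (r₀ : ℝ) ^ n := by
          gcongr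
          rw [hρ]; push_cast
          rw [mul_div_assoc', div_le_iff₀ (by positivity)]
          nlinarith [r₀.2]
      _ ≤ C := hpC n
  have hF : HasFPowerSeriesOnBall P.sum P 0 P.radius :=
    P.hasFPowerSeriesOnBall (lt_of_lt_of_le (by exact_mod_cast hρpos) hrad)
  have hmem : ∀ v ∈ Metric.ball (0 : Fin d → A) ρ, v ∈ Metric.eball (0 : Fin d → A) P.radius := by
    intro v hv
    refine Metric.eball_subset_eball hrad ?_
    rwa [Metric.eball_coe]
  refine ⟨P.sum, fun v hv => hF.analyticAt_of_mem (hmem v hv), fun χ hχ v hv => ?_⟩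
  have h1 := hF.hasSum_sub (hmem v hv)
  let χ' : A →L[ℝ] ℝ := χ.toLinearMap.mkContinuous 1 (by simpa using hχ)
  have h2 := χ'.hasSum h1
  have hv' : (fun i => χ (v i)) ∈ Metric.eball (0 : Fin d → ℝ) r := by
    refine Metric.eball_subset_eball hr₀r.le ?_
    rw [Metric.eball_coe]
    rw [mem_ball_zero_iff] at hv ⊢
    refine lt_of_le_of_lt ((pi_norm_le_iff_of_nonneg (norm_nonneg v)).2 fun i =>
      (hχ _).trans (norm_le_pi_norm v i)) (hv.trans_le (by exact_mod_cast hρr))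
  have h3 := hp.hasSum_sub hv'
  simp only [sub_zero] at h2 h3
  refine h2.unique (h3.congr_fun fun n => ?_)
  have h4 : ∀ a, χ' a = χ a := fun _ => rfl
  have h5 : (fun i => χ (v i)) = ∑ j, χ (v j) • e j := by
    ext i
    simp [e, Finset.sum_apply, Pi.single_apply]
  rw [h4, h5, (p n).map_sum]
  simp [P, map_sum, map_prod, (p n).map_smul_univ, mul_comm]

theorem exists_germ_algebra {ε : ℝ} (hε : 0 < ε) :
    ∃ (A : Type) (_ : NormedCommRing A) (_ : NormedAlgebra ℝ A) (_ : CompleteSpace A)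
      (_ : NormOneClass A) (z : A) (χ : ℝ → A →ₐ[ℝ] ℝ), ‖z‖ ≤ ε ∧
      (∀ t, |t| ≤ ε → χ t z = t) ∧ (∀ t a, ‖χ t a‖ ≤ ‖a‖) ∧ (∀ a, Continuous fun t => χ t a) ∧
      (∀ b, ε * ‖b‖ ≤ ‖z * b‖) ∧ (∀ a, χ 0 a = 0 → ∃ b, a = z * b) := by
  let K := Metric.closedBall (0 : ℂ) ε
  have : CompactSpace K := isCompact_iff_compactSpace.1 (isCompact_closedBall 0 ε)
  have : Nonempty K := ⟨⟨0, by simp [K, hε.le]⟩⟩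
  let w₀ : K := ⟨0, by simp [K, hε.le]⟩
  let Z : C(K, ℂ) := ⟨Subtype.val, continuous_subtype_val⟩
  let S : Subalgebra ℝ C(K, ℂ) := Algebra.adjoin ℝ {Z}
  have hSc : (S.topologicalClosure : Set C(K, ℂ)) = closure S := S.topologicalClosure_coe
  have hS : ∀ a ∈ S, ∃ p : Polynomial ℝ, a = Polynomial.aeval Z p := by
    intro a ha
    simp only [S, Algebra.adjoin_singleton_eq_range_aeval] at ha
    obtain ⟨p, rfl⟩ := ha
    exact ⟨p, rfl⟩
  have hev : ∀ (p : Polynomial ℝ) (w : K), (Polynomial.aeval Z p) w = Polynomial.aeval (w : ℂ) p := by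
    intro p w
    induction p using Polynomial.induction_on with
    | C a => simp
    | add p q hp hq => simp [hp, hq]
    | monomial n a h => simp [Z]
  -- maximum modulus
  have hmaxS : ∀ b ∈ S, ε * ‖b‖ ≤ ‖Z * b‖ := by
    intro b hb
    obtain ⟨p, rfl⟩ := hS b hb
    rw [← le_div_iff₀' hε]
    refine (ContinuousMap.norm_le _ (by positivity)).2 fun w => ?_
    rw [hev]
    refine Complex.norm_le_of_forall_mem_frontier_norm_le (f := fun w : ℂ => Polynomial.aeval w p)
      (U := Metric.ball 0 ε) Metric.isBounded_ball (Differentiable.diffContOnCl ?_) (fun u hu => ?_)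
      (by rw [closure_ball _ hε.ne']; exact w.2)
    · exact Polynomial.differentiable_aeval p
    · rw [frontier_ball _ hε.ne'] at hu
      have hu' : ‖u‖ = ε := by simpa using hu
      rw [le_div_iff₀' hε]
      have := ContinuousMap.norm_coe_le_norm (Z * Polynomial.aeval Z p) ⟨u, by simp [K, hu']⟩
      rw [ContinuousMap.mul_apply, hev, norm_mul] at this
      simpa [Z, hu'] using this
  have hmax : ∀ b ∈ S.topologicalClosure, ε * ‖b‖ ≤ ‖Z * b‖ := by
    intro b hb
    have hb' : b ∈ closure (S : Set C(K, ℂ)) := hSc ▸ hb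
    refine closure_minimal (s := (S : Set C(K, ℂ))) (t := {b | ε * ‖b‖ ≤ ‖Z * b‖}) hmaxS ?_ hb'
    exact isClosed_le (by fun_prop) (by fun_prop)
  have hZ : Z ∈ S := Algebra.subset_adjoin rfl
  -- division
  have hdiv : ∀ a ∈ S.topologicalClosure, a w₀ = 0 →
      ∃ b ∈ S.topologicalClosure, a = Z * b := by
    intro a ha ha0
    have ha' : a ∈ closure (S : Set C(K, ℂ)) := hSc ▸ ha
    obtain ⟨s, hs, hsa⟩ := mem_closure_iff_seq_limit.1 ha'
    choose p hp using fun n => hS _ (hs n)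
    let q : ℕ → C(K, ℂ) := fun n => Polynomial.aeval Z (p n).divX
    have hq : ∀ n, Z * q n = s n - algebraMap ℝ _ ((p n).coeff 0) := by
      intro n
      have := congrArg (Polynomial.aeval Z) (Polynomial.divX_mul_X_add (p n))
      rw [map_add, map_mul, Polynomial.aeval_X, Polynomial.aeval_C, ← hp n] at this
      rw [← this, add_sub_cancel_right, mul_comm]
    have hqS : ∀ n, q n ∈ S := fun n => by
      simp only [q, S, Algebra.adjoin_singleton_eq_range_aeval]
      exact ⟨_, rfl⟩
    have hs0 : ∀ n, s n w₀ = ((p n).coeff 0 : ℂ) := by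
      intro n
      rw [hp n, hev]
      simp [w₀, Polynomial.aeval_def, Polynomial.eval₂_at_zero]
    have hc : Tendsto (fun n => ((p n).coeff 0 : ℂ)) atTop (𝓝 0) := by
      have : Tendsto (fun n => s n w₀) atTop (𝓝 0) := by
        rw [← ha0]
        exact ((continuous_eval_const _).tendsto a).comp hsa
      simpa only [hs0] using this
    have hc' : Tendsto (fun n => ((p n).coeff 0)) atTop (𝓝 0) := by
      simpa [Function.comp_def] using (Complex.continuous_re.tendsto _).comp hc
    have hlim : Tendsto (fun n => Z * q n) atTop (𝓝 a) := by
      simp only [hq]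
      have := hsa.sub (((algebraMapCLM ℝ C(K, ℂ)).continuous.tendsto _).comp hc')
      simpa using this
    have hcau : CauchySeq q := by
      have h1 := hlim.cauchySeq
      rw [Metric.cauchySeq_iff] at h1 ⊢
      intro δ hδ
      obtain ⟨N, hN⟩ := h1 (ε * δ) (by positivity)
      refine ⟨N, fun m hm n hn => ?_⟩
      have h2 := hN m hm n hn
      rw [dist_eq_norm, ← mul_sub] at h2
      rw [dist_eq_norm]
      exact lt_of_mul_lt_mul_left
        ((hmaxS _ (S.sub_mem (hqS m) (hqS n))).trans_lt h2) hε.le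
    obtain ⟨b, hb⟩ := cauchySeq_tendsto_of_complete hcau
    refine ⟨b, ?_, tendsto_nhds_unique hlim (hb.const_mul Z)⟩
    have : b ∈ closure (S : Set C(K, ℂ)) :=
      mem_closure_of_tendsto hb (Eventually.of_forall hqS)
    rw [← hSc] at this
    exact this
  -- real points
  let c : ℝ → K := fun t => ⟨((max (-ε) (min t ε) : ℝ) : ℂ), by
    simp only [K, mem_closedBall_zero_iff, Complex.norm_real, Real.norm_eq_abs, abs_le]
    exact ⟨le_max_left _ _, max_le (by linarith) (min_le_right _ _)⟩⟩
  have hcc : Continuous c := by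
    refine Continuous.subtype_mk ?_ _
    fun_prop
  have him : ∀ a ∈ S.topologicalClosure, ∀ t, (a (c t)).im = 0 := by
    intro a ha t
    have ha' : a ∈ closure (S : Set C(K, ℂ)) := hSc ▸ ha
    refine closure_minimal (s := (S : Set C(K, ℂ))) (t := {b | (b (c t)).im = 0}) ?_ ?_ ha'
    · intro b hb
      obtain ⟨p, rfl⟩ := hS b hb
      simp only [mem_ofPred_eq, hev, c]
      rw [← Complex.ofRealAm_coe, Polynomial.aeval_algHom_apply]
      simp
    · exact isClosed_eq (Complex.continuous_im.comp (continuous_eval_const _))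
        continuous_const
  let χ : ℝ → S.topologicalClosure →ₐ[ℝ] ℝ := fun t =>
    { toFun := fun a => (a.1 (c t)).re
      map_one' := by simp
      map_mul' := fun a b => by simp [him a.1 a.2, him b.1 b.2]
      map_zero' := by simp
      map_add' := fun a b => by simp
      commutes' := fun r => by simp }
  have : IsClosed (S.topologicalClosure : Set C(K, ℂ)) := S.isClosed_topologicalClosure
  have hcomp : CompleteSpace S.topologicalClosure := this.completeSpace_coe
  refine ⟨S.topologicalClosure, inferInstance, inferInstance, hcomp, ⟨?_⟩, ⟨Z, S.le_topologicalClosure hZ⟩,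
    χ, ?_, ?_, ?_, ?_, ?_, ?_⟩
  · exact norm_one (α := C(K, ℂ))
  · exact (ContinuousMap.norm_le _ hε.le).2 fun w => mem_closedBall_zero_iff.1 w.2
  · intro t ht
    rw [abs_le] at ht
    simp [χ, Z, c, ht.1, ht.2]
  · intro t a
    exact (Complex.abs_re_le_norm _).trans (ContinuousMap.norm_coe_le_norm a.1 _)
  · intro a
    exact Complex.continuous_re.comp (a.1.continuous.comp hcc)
  · intro b
    exact hmax b.1 b.2
  · intro a ha
    have hc0 : c 0 = w₀ := by simp [c, w₀, hε.le]
    obtain ⟨b, hb, hab⟩ := hdiv a.1 a.2 (by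
      rw [← hc0]; exact Complex.ext ha (him a.1 a.2 0))
    exact ⟨⟨b, hb⟩, Subtype.ext hab⟩

theorem weierstrass_division_bijective {A : Type} [CommRing A] [Algebra ℝ A] (z : A)
    (χ : A →ₐ[ℝ] ℝ) (hχz : χ z = 0) (hinj : ∀ b, z * b = 0 → b = 0)
    (hdiv : ∀ a, χ a = 0 → ∃ b, a = z * b) (u : A) (hu : χ u ≠ 0) (m : ℕ) :
    (∀ (α : Fin m → ℝ) (v : A), (∑ j, α j • z ^ (j : ℕ)) * u + z ^ m * v = 0 → α = 0 ∧ v = 0) ∧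
    ∀ g : A, ∃ (α : Fin m → ℝ) (v : A), (∑ j, α j • z ^ (j : ℕ)) * u + z ^ m * v = g := by
  induction m with
  | zero =>
    refine ⟨fun α v h => ⟨Subsingleton.elim _ _, by simpa using h⟩, fun g => ⟨0, g, by simp⟩⟩
  | succ m ih =>
    have key : ∀ (α : Fin (m + 1) → ℝ) (v : A),
        (∑ j, α j • z ^ (j : ℕ)) * u + z ^ (m + 1) * v =
        α 0 • u + z * ((∑ j : Fin m, α j.succ • z ^ (j : ℕ)) * u + z ^ m * v) := by
      intro α v
      have : ∑ j : Fin m, α j.succ • z ^ ((j : ℕ) + 1) = z * ∑ j : Fin m, α j.succ • z ^ (j : ℕ) := by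
        rw [Finset.mul_sum]
        exact Finset.sum_congr rfl fun j _ => by rw [mul_smul_comm, pow_succ']
      rw [Fin.sum_univ_succ]
      simp only [Fin.val_zero, pow_zero, Fin.val_succ, this, add_mul, smul_mul_assoc, one_mul]
      ring
    constructor
    · intro α v h
      rw [key] at h
      have h0 : α 0 = 0 := by
        have := congrArg χ h
        simpa [hχz, hu] using this
      rw [h0, zero_smul, zero_add] at h
      obtain ⟨h1, h2⟩ := ih.1 _ _ (hinj _ h)
      refine ⟨funext fun j => Fin.cases h0 (fun j => congrFun h1 j) j, h2⟩
    · intro g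
      obtain ⟨q, hq⟩ := hdiv (g - (χ g / χ u) • u) (by simp [hu])
      obtain ⟨α, v, h⟩ := ih.2 q
      refine ⟨Fin.cons (χ g / χ u) α, v, ?_⟩
      rw [key]
      simp only [Fin.cons_zero, Fin.cons_succ, h, ← hq]
      ring

theorem AnalyticAt.exists_weierstrass_polynomial {n : ℕ} {f : (Fin (n + 1) → ℝ) → ℝ}
    (hf : AnalyticAt ℝ f 0)
    (hreg : ∃ᶠ t in 𝓝 (0 : ℝ), f (Fin.cons t (0 : Fin n → ℝ)) ≠ 0) :
    ∃ (m : ℕ) (a : Fin m → (Fin n → ℝ) → ℝ), (∀ j, AnalyticAt ℝ (a j) 0) ∧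
      ∀ᶠ y in 𝓝 (0 : Fin (n + 1) → ℝ),
        (f y = 0 ↔ y 0 ^ m + ∑ j, a j (Fin.tail y) * y 0 ^ (j : ℕ) = 0) := by
  obtain ⟨ρ, hρ, hext⟩ := exists_banachAlgebra_extension hf
  set ε := ρ / 2 with hε
  have hεpos : 0 < ε := by positivity
  have hερ : ε < ρ := half_lt_self hρ
  obtain ⟨A, _, _, _, _, z, χ, hz, hχz, hχn, hχc, hmax, hdiv⟩ := exists_germ_algebra hεpos
  obtain ⟨F, hF, hFχ⟩ := hext A
  have hinj : ∀ b, z * b = 0 → b = 0 := fun b hb => by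
    have := hmax b
    rw [hb, norm_zero] at this
    exact norm_le_zero_iff.1 (nonpos_of_mul_nonpos_right this hεpos)
  have hχ0 : χ 0 z = 0 := hχz 0 (by simp [hεpos.le])
  let c : (Fin n → ℝ) → Fin (n + 1) → A := fun x => Fin.cons z (fun i => algebraMap ℝ A (x i))
  have hc : AnalyticAt ℝ c 0 := by
    refine AnalyticAt.pi fun i => ?_
    refine Fin.cases ?_ (fun i => ?_) i
    · simpa [c] using analyticAt_const
    · simp only [Fin.cons_succ]
      exact ((algebraMapCLM ℝ A).comp (ContinuousLinearMap.proj (R := ℝ) (φ := fun _ => ℝ) i)).analyticAt 0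
  have hcball : ∀ᶠ x in 𝓝 0, c x ∈ Metric.ball (0 : Fin (n + 1) → A) ρ := by
    refine hc.continuousAt.eventually_mem (Metric.isOpen_ball.mem_nhds ?_)
    rw [mem_ball_zero_iff, pi_norm_lt_iff hρ]
    intro i
    refine Fin.cases ?_ (fun i => ?_) i
    · simpa [c] using hz.trans_lt hερ
    · simpa [c] using hρ
  have hG : AnalyticAt ℝ (fun x => F (c x)) 0 := (hF _ hcball.self_of_nhds).comp hc
  have hGχ : ∀ᶠ x in 𝓝 0, ∀ t, |t| ≤ ε → χ t (F (c x)) = f (Fin.cons t x) := by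
    filter_upwards [hcball] with x hx t ht
    rw [hFχ (χ t) (hχn t) _ hx]
    congr 1
    ext i
    refine Fin.cases ?_ (fun i => ?_) i
    · simp [c, hχz t ht]
    · simp [c]
  obtain ⟨m, u₀, hu₀, hu₀χ⟩ : ∃ m u₀, F (c 0) = z ^ m * u₀ ∧ χ 0 u₀ ≠ 0 := by
    by_contra! hcon
    have hall : ∀ m, ∃ b, F (c 0) = z ^ m * b := by
      intro m
      induction m with
      | zero => exact ⟨F (c 0), by simp⟩
      | succ m ih =>
        obtain ⟨b, hb⟩ := ih
        obtain ⟨b', rfl⟩ := hdiv b (hcon m b hb)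
        exact ⟨b', by rw [hb]; ring⟩
    have hpow : ∀ m b, ε ^ m * ‖b‖ ≤ ‖z ^ m * b‖ := by
      intro m
      induction m with
      | zero => simp
      | succ m ih =>
        intro b
        calc ε ^ (m + 1) * ‖b‖ = ε ^ m * (ε * ‖b‖) := by ring
          _ ≤ ε ^ m * ‖z * b‖ := by gcongr; exact hmax b
          _ ≤ _ := ih _
          _ = _ := by rw [← mul_assoc, pow_succ]
    refine hreg ?_
    filter_upwards [Metric.ball_mem_nhds (0 : ℝ) hεpos] with t ht
    rw [mem_ball_zero_iff, Real.norm_eq_abs] at ht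
    rw [not_not, ← hGχ.self_of_nhds t ht.le]
    have hlim : Tendsto (fun m : ℕ => (|t| / ε) ^ m * ‖F (c 0)‖) atTop (𝓝 0) := by
      simpa using (tendsto_pow_atTop_nhds_zero_of_lt_one (by positivity)
        ((div_lt_one hεpos).2 ht)).mul_const ‖F (c 0)‖
    refine norm_le_zero_iff.1 (ge_of_tendsto' hlim fun m => ?_)
    obtain ⟨b, hb⟩ := hall m
    rw [div_pow, div_mul_eq_mul_div, le_div_iff₀ (by positivity)]
    calc ‖χ t (F (c 0))‖ * ε ^ m = |t| ^ m * (‖χ t b‖ * ε ^ m) := by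
          rw [hb, map_mul, map_pow, hχz t ht.le, norm_mul, norm_pow, Real.norm_eq_abs]; ring
      _ ≤ |t| ^ m * (ε ^ m * ‖b‖) := by rw [mul_comm (ε ^ m)]; gcongr; exact hχn t b
      _ ≤ _ := by rw [hb]; gcongr; exact hpow m b
  obtain ⟨hT1, hT2⟩ := weierstrass_division_bijective z (χ 0) hχ0 hinj hdiv u₀ hu₀χ m
  let Q : (Fin m → ℝ) →L[ℝ] A :=
    ∑ j : Fin m, (ContinuousLinearMap.proj (R := ℝ) (φ := fun _ : Fin m => ℝ) j).smulRight (z ^ (j : ℕ))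
  have hQ : ∀ α, Q α = ∑ j, α j • z ^ (j : ℕ) := fun α => by
    simp [Q]
  let T : (Fin m → ℝ) × A →L[ℝ] A :=
    ((ContinuousLinearMap.mul ℝ A).flip u₀).comp (Q.comp (ContinuousLinearMap.fst ℝ _ _)) +
      (ContinuousLinearMap.mul ℝ A (z ^ m)).comp (ContinuousLinearMap.snd ℝ _ _)
  have hT : ∀ α v, T (α, v) = (∑ j, α j • z ^ (j : ℕ)) * u₀ + z ^ m * v := by
    intro α v
    simp only [T, hQ, add_apply, ContinuousLinearMap.comp_apply,
      ContinuousLinearMap.flip_apply, ContinuousLinearMap.mul_apply', ContinuousLinearMap.coe_fst',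
      ContinuousLinearMap.coe_snd']
  let e : ((Fin m → ℝ) × A) ≃L[ℝ] A := ContinuousLinearEquiv.ofBijective T
    (LinearMap.ker_eq_bot'.2 fun ⟨α, v⟩ h => by
      obtain ⟨h1, h2⟩ := hT1 α v (by rw [← hT]; exact h)
      rw [h1, h2]; rfl)
    (LinearMap.range_eq_top.2 fun g => by
      obtain ⟨α, v, h⟩ := hT2 g
      exact ⟨(α, v), by rw [← h]; exact hT α v⟩)
  let H : (Fin m → ℝ) × A → A := fun w => (z ^ m + Q w.1) * w.2
  have hHa : AnalyticAt ℝ H (0, u₀) := by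
    refine AnalyticAt.mul (analyticAt_const.add ?_) analyticAt_snd
    exact (Q.analyticAt _).comp analyticAt_fst
  have hH' : HasFDerivAt H (e : ((Fin m → ℝ) × A) →L[ℝ] A) (0, u₀) := by
    have h1 : HasFDerivAt (fun w : (Fin m → ℝ) × A => z ^ m + Q w.1)
        (Q.comp (ContinuousLinearMap.fst ℝ _ _)) (0, u₀) :=
      (Q.hasFDerivAt.comp _ hasFDerivAt_fst).const_add _
    refine (h1.mul hasFDerivAt_snd).congr_fderiv ?_
    ext w
    · simp only [e, T, hQ, add_apply, ContinuousLinearMap.comp_apply,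
        ContinuousLinearMap.coe_fst', ContinuousLinearMap.coe_snd', ContinuousLinearEquiv.coe_ofBijective]
      simp [hQ]
      rw [Finset.mul_sum]
      exact Finset.sum_congr rfl fun j _ => by rw [mul_smul_comm]
    · simp [e, T, hQ]
  have hHc : ContDiffAt ℝ ⊤ H (0, u₀) := hHa.contDiffAt
  have hH0 : H (0, u₀) = F (c 0) := by simp [H, hu₀]
  let Ψ := hHc.localInverse hH' (by simp)
  have hΨa : AnalyticAt ℝ Ψ (F (c 0)) := by
    have := hHc.to_localInverse hH' (by simp)
    rw [hH0] at this
    exact this.analyticAt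
  have hΨr : ∀ᶠ y in 𝓝 (F (c 0)), H (Ψ y) = y := by
    rw [← hH0]
    exact (hHc.hasStrictFDerivAt' hH' (by simp)).eventually_right_inverse
  have hΨ0 : Ψ (F (c 0)) = (0, u₀) := by
    rw [← hH0]
    exact hHc.localInverse_apply_image hH' (by simp)
  have hΨG : AnalyticAt ℝ (fun x => Ψ (F (c x))) 0 := AnalyticAt.fun_comp (g := Ψ) (f := fun x => F (c x)) hΨa hG
  refine ⟨m, fun j x => (Ψ (F (c x))).1 j, fun j => ?_, ?_⟩
  · exact ((ContinuousLinearMap.proj (R := ℝ) (φ := fun _ : Fin m => ℝ) j).analyticAt _).comp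
      (AnalyticAt.fun_comp (g := Prod.fst) analyticAt_fst hΨG)
  · have htail : Tendsto (fun y : Fin (n + 1) → ℝ => Fin.tail y) (𝓝 0) (𝓝 0) := by
      have : Continuous (fun y : Fin (n + 1) → ℝ => Fin.tail y) := by
        unfold Fin.tail; fun_prop
      exact this.tendsto' _ _ rfl
    have h0 : Tendsto (fun y : Fin (n + 1) → ℝ => y 0) (𝓝 0) (𝓝 0) :=
      (continuous_apply 0).tendsto' _ _ rfl
    have hu : Tendsto (fun y : Fin (n + 1) → ℝ => χ (y 0) (Ψ (F (c (Fin.tail y)))).2) (𝓝 0)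
        (𝓝 (χ 0 u₀)) := by
      have h1 : Tendsto (fun y : Fin (n + 1) → ℝ => (Ψ (F (c (Fin.tail y)))).2) (𝓝 0) (𝓝 u₀) := by
        have := (continuous_snd.continuousAt.comp hΨG.continuousAt).tendsto.comp htail
        simpa [Function.comp_def, hΨ0] using this
      have h2 : Tendsto (fun y : Fin (n + 1) → ℝ => χ (y 0) u₀) (𝓝 0) (𝓝 (χ 0 u₀)) :=
        ((hχc u₀).tendsto 0).comp h0
      have h3 : Tendsto (fun y : Fin (n + 1) → ℝ => χ (y 0) ((Ψ (F (c (Fin.tail y)))).2 - u₀)) (𝓝 0)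
          (𝓝 0) := by
        refine squeeze_zero_norm (fun y => hχn _ _) ?_
        simpa using (h1.sub_const u₀).norm
      simpa using h3.add h2
    have hHΨ : ∀ᶠ x in 𝓝 0, H (Ψ (F (c x))) = F (c x) := hG.continuousAt.eventually hΨr
    filter_upwards [hu.eventually_ne hu₀χ, htail.eventually hHΨ, htail.eventually hGχ,
      h0.eventually (Metric.ball_mem_nhds (0 : ℝ) hεpos)] with y hy1 hy2 hy3 hy4
    have hy5 : |y 0| ≤ ε := by simpa using (mem_ball_zero_iff.1 hy4).le
    have hy6 := hy3 (y 0) hy5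
    rw [Fin.cons_self_tail, ← hy2] at hy6
    rw [← hy6]
    simp only [H, map_mul, mul_eq_zero, hy1, or_false, map_add, map_pow, hχz _ hy5, hQ, map_sum,
      map_smul, smul_eq_mul]

theorem Polynomial.exists_generalized_discriminants (M : ℕ) :
    ∃ B : ℕ → MvPolynomial (Fin M) ℝ, ∀ p : Polynomial ℝ, p.Monic → p.natDegree = M →
      MvPolynomial.aeval (fun i : Fin M => p.coeff i)
        (B (p.map (algebraMap ℝ ℂ)).roots.toFinset.card) ≠ 0 ∧
      ∀ r, (p.map (algebraMap ℝ ℂ)).roots.toFinset.card < r →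
        MvPolynomial.aeval (fun i : Fin M => p.coeff i) (B r) = 0 := by
  let D : ℕ → MvPolynomial (Fin M) ℝ := fun r =>
    ∑ s ∈ Finset.powersetCard r Finset.univ, ∏ p ∈ s.offDiag,
      (MvPolynomial.X p.1 - MvPolynomial.X p.2)
  have hsymm : ∀ r, (D r).IsSymmetric := by
    intro r e
    simp only [D, map_sum, map_prod, map_sub, MvPolynomial.rename_X]
    refine Finset.sum_bij' (fun s _ => s.map e.toEmbedding) (fun s _ => s.map e.symm.toEmbedding)
      ?_ ?_ ?_ ?_ ?_
    · intro s hs; simpa using hs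
    · intro s hs; simpa using hs
    · intro s hs; ext; simp
    · intro s hs; ext; simp
    · intro s hs
      refine Finset.prod_bij' (fun p _ => (e p.1, e p.2)) (fun p _ => (e.symm p.1, e.symm p.2))
        ?_ ?_ ?_ ?_ ?_ <;> simp [Finset.mem_offDiag]
  have hsurj : ∀ r, ∃ B : MvPolynomial (Fin M) ℝ,
      MvPolynomial.aeval (fun i : Fin M => MvPolynomial.esymm (Fin M) ℝ (i + 1)) B = D r := by
    intro r
    obtain ⟨B, hB⟩ := MvPolynomial.esymmAlgHom_surjective (σ := Fin M) (R := ℝ) (n := M) (by simp)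
      ⟨D r, hsymm r⟩
    exact ⟨B, by rw [← MvPolynomial.esymmAlgHom_apply, hB]⟩
  choose B hB using hsurj
  refine ⟨fun r => MvPolynomial.aeval (fun i : Fin M =>
    MvPolynomial.C ((-1 : ℝ) ^ ((i : ℕ) + 1)) * MvPolynomial.X (Fin.rev i)) (B r), ?_⟩
  intro p hp hpM
  set P := p.map (algebraMap ℝ ℂ) with hP
  have hPm : P.Monic := hp.map _
  have hPd : P.natDegree = M := by rw [hP, hp.natDegree_map, hpM]
  have hcard : Multiset.card P.roots = P.natDegree :=
    (Polynomial.splits_iff_card_roots.1 (IsAlgClosed.splits P))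
  obtain ⟨z, hz⟩ : ∃ z : Fin M → ℂ, Finset.univ.val.map z = P.roots := by
    obtain ⟨l, hl⟩ := Quot.exists_rep P.roots
    have hl' : (l : Multiset ℂ) = P.roots := hl
    have hlen : l.length = M := by rw [← hPd, ← hcard, ← hl', Multiset.coe_card]
    subst hlen
    refine ⟨l.get, ?_⟩
    rw [← hl']
    simp
  have heval : ∀ r, ((MvPolynomial.aeval (fun i : Fin M => p.coeff i)
      (MvPolynomial.aeval (fun i : Fin M =>
        (MvPolynomial.C ((-1 : ℝ) ^ ((i : ℕ) + 1)) * MvPolynomial.X (Fin.rev i) :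
          MvPolynomial (Fin M) ℝ)) (B r)) : ℝ) : ℂ) = MvPolynomial.aeval z (D r) := by
    intro r
    rw [← hB r]
    rw [← Complex.coe_algebraMap, ← MvPolynomial.aeval_algebraMap_apply, ← AlgHom.comp_apply, ← AlgHom.comp_apply]
    congr 1
    ext i
    have hi := i.2
    have hco := Polynomial.coeff_eq_esymm_roots_of_card hcard (k := M - (i + 1)) (by omega)
    rw [hPm.leadingCoeff, hPd, one_mul, show M - (M - ((i : ℕ) + 1)) = i + 1 by omega, hP,
      Polynomial.coeff_map, ← hP] at hco
    simp only [AlgHom.comp_apply, MvPolynomial.aeval_X, map_mul, MvPolynomial.aeval_C,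
      MvPolynomial.aeval_esymm_eq_multiset_esymm, hz, Function.comp_apply, Fin.val_rev]
    rw [hco, ← mul_assoc]
    simp [← mul_pow]
  have hinj : ∀ s : Finset (Fin M), (∏ p ∈ s.offDiag, (z p.1 - z p.2) ≠ 0 ↔ Set.InjOn z s) := by
    intro s
    rw [Finset.prod_ne_zero_iff]
    constructor
    · intro h i hi j hj hij
      by_contra hne
      exact h (i, j) (Finset.mem_offDiag.2 ⟨hi, hj, hne⟩) (sub_eq_zero.2 hij)
    · intro h q hq hq0
      obtain ⟨h1, h2, h3⟩ := Finset.mem_offDiag.1 hq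
      exact h3 (h h1 h2 (sub_eq_zero.1 hq0))
  have himg : P.roots.toFinset = Finset.univ.image z := by
    ext x; simp [← hz]
  have haev : ∀ r, MvPolynomial.aeval z (D r) =
      ∑ s ∈ Finset.powersetCard r Finset.univ, ∏ p ∈ s.offDiag, (z p.1 - z p.2) := by
    intro r; simp [D]
  have hbig : ∀ r, P.roots.toFinset.card < r → MvPolynomial.aeval z (D r) = 0 := by
    intro r hr
    rw [haev]
    refine Finset.sum_eq_zero fun s hs => ?_
    by_contra hne
    have hcs := Finset.card_image_of_injOn ((hinj s).1 hne)
    have : (s.image z).card ≤ (Finset.univ.image z).card :=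
      Finset.card_le_card (Finset.image_subset_image (Finset.subset_univ s))
    rw [himg] at hr
    rw [(Finset.mem_powersetCard.1 hs).2] at hcs
    omega
  refine ⟨fun h0 => ?_, fun r hr => ?_⟩
  · have h1 := heval P.roots.toFinset.card
    rw [h0, haev, ← Finset.sum_filter_ne_zero] at h1
    have h2 : ∀ s ∈ (Finset.powersetCard P.roots.toFinset.card Finset.univ).filter
        (fun s : Finset (Fin M) => ∏ p ∈ s.offDiag, (z p.1 - z p.2) ≠ 0),
        ∏ p ∈ s.offDiag, (z p.1 - z p.2) = ∏ p ∈ P.roots.toFinset.offDiag, (p.1 - p.2) := by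
      intro s hs
      obtain ⟨hs1, hs2⟩ := Finset.mem_filter.1 hs
      have hi := (hinj s).1 hs2
      have him : s.image z = P.roots.toFinset := by
        rw [himg]
        refine Finset.eq_of_subset_of_card_le
          (Finset.image_subset_image (Finset.subset_univ s)) ?_
        rw [Finset.card_image_of_injOn hi, (Finset.mem_powersetCard.1 hs1).2, himg]
      rw [← him]
      refine Finset.prod_bij (fun p _ => (z p.1, z p.2)) ?_ ?_ ?_ ?_
      · intro q hq
        obtain ⟨h1, h2, h3⟩ := Finset.mem_offDiag.1 hq
        exact Finset.mem_offDiag.2 ⟨Finset.mem_image_of_mem _ h1, Finset.mem_image_of_mem _ h2,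
          fun h => h3 (hi h1 h2 h)⟩
      · intro q hq q' hq' h
        obtain ⟨h1, h2, -⟩ := Finset.mem_offDiag.1 hq
        obtain ⟨h1', h2', -⟩ := Finset.mem_offDiag.1 hq'
        rw [Prod.mk.injEq] at h
        exact Prod.ext (hi h1 h1' h.1) (hi h2 h2' h.2)
      · intro w hw
        obtain ⟨h1, h2, h3⟩ := Finset.mem_offDiag.1 hw
        obtain ⟨i, hi1, hi2⟩ := Finset.mem_image.1 h1
        obtain ⟨j, hj1, hj2⟩ := Finset.mem_image.1 h2
        refine ⟨(i, j), Finset.mem_offDiag.2 ⟨hi1, hj1, ?_⟩, Prod.ext hi2 hj2⟩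
        intro hij
        exact h3 (hi2.symm.trans ((congrArg z hij).trans hj2))
      · intros; rfl
    rw [Finset.sum_congr rfl h2, Finset.sum_const, nsmul_eq_mul, Complex.ofReal_zero, eq_comm,
      mul_eq_zero, Nat.cast_eq_zero, Finset.card_eq_zero] at h1
    rcases h1 with h1 | h1
    · obtain ⟨s, -, hs, hs2⟩ := Finset.exists_subset_injOn_image_eq_of_surjOn
        (s := (Set.univ : Set (Fin M))) (f := z) P.roots.toFinset (by
          intro x hx
          rw [himg] at hx
          simpa using hx)
      have hsc : s.card = P.roots.toFinset.card := by
        rw [← Finset.card_image_of_injOn hs, hs2]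
      have : s ∈ (∅ : Finset (Finset (Fin M))) := by
        rw [← h1]
        exact Finset.mem_filter.2 ⟨Finset.mem_powersetCard.2 ⟨Finset.subset_univ _, hsc⟩,
          (hinj s).2 hs⟩
      simp at this
    · rw [Finset.prod_eq_zero_iff] at h1
      obtain ⟨q, hq, hq0⟩ := h1
      exact (Finset.mem_offDiag.1 hq).2.2 (sub_eq_zero.1 hq0)
  · have h1 := heval r
    rw [hbig r hr] at h1
    exact_mod_cast h1

namespace Polynomial

theorem eval_iterate_derivative_eq_sum {R : Type*} [CommRing R] {M : ℕ} {p : R[X]}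
    (hp : p.natDegree = M) (j : ℕ) (x : R) :
    (derivative^[j] p).eval x =
      ∑ i ∈ Finset.range (M + 1), ((i + j).descFactorial j • p.coeff (i + j)) * x ^ i := by
  rw [eval_eq_sum_range' (n := M + 1)]
  · simp only [coeff_iterate_derivative]
  · have := natDegree_iterate_derivative p j
    omega

theorem continuousAt_eval_iterate_derivative {T : Type*} [TopologicalSpace T] {K : Type*}
    [NormedField K] {M : ℕ} {P : T → K[X]} (hd : ∀ s, (P s).natDegree = M) {s₀ : T}
    (hc : ∀ i, ContinuousAt (fun s => (P s).coeff i) s₀) (j : ℕ) (w : K) :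
    ContinuousAt (fun y : T × K => (derivative^[j] (P y.1)).eval y.2) (s₀, w) := by
  simp only [fun y : T × K => eval_iterate_derivative_eq_sum (hd y.1) j y.2]
  refine tendsto_finsetSum _ fun i _ => ?_
  simp only [nsmul_eq_mul]
  refine ContinuousAt.mul (continuousAt_const.mul ?_) (continuousAt_snd.pow _)
  exact ContinuousAt.comp (g := fun s => (P s).coeff (i + j)) (f := Prod.fst) (hc _) continuousAt_fst

theorem iterate_derivative_rootMultiplicity_ne_zero {K : Type*} [Field K] [CharZero K] {p : K[X]}
    (hp : p ≠ 0) (w : K) : (derivative^[p.rootMultiplicity w] p).eval w ≠ 0 := by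
  intro h
  refine lt_irrefl (p.rootMultiplicity w)
    ((lt_rootMultiplicity_iff_isRoot_iterate_derivative hp).2 fun m hm => ?_)
  rcases hm.lt_or_eq with hm | rfl
  · exact isRoot_iterate_derivative_of_lt_rootMultiplicity hm
  · exact h

theorem eventually_exists_isRoot_dist_lt {T : Type*} [TopologicalSpace T] {M : ℕ} {P : T → ℂ[X]}
    (hm : ∀ s, (P s).Monic) (hd : ∀ s, (P s).natDegree = M) {s₀ : T}
    (hc : ∀ i, ContinuousAt (fun s => (P s).coeff i) s₀) {w : ℂ} (hw : (P s₀).IsRoot w) {r : ℝ}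
    (hr : 0 < r) : ∀ᶠ s in 𝓝 s₀, ∃ w', (P s).IsRoot w' ∧ dist w' w < r := by
  have hcont : ContinuousAt (fun s => ‖(P s).eval w‖) s₀ :=
    (ContinuousAt.comp (f := fun s => (s, w)) (continuousAt_eval_iterate_derivative hd hc 0 w)
      (by fun_prop)).norm
  have h0 : ‖(P s₀).eval w‖ < r ^ M := by
    rw [hw.eq_zero, norm_zero]; positivity
  filter_upwards [hcont.eventually (gt_mem_nhds h0)] with s hs
  by_contra! hcon
  refine hs.not_ge ?_
  rw [(IsAlgClosed.splits (P s)).eval_eq_prod_roots_of_monic (hm s)]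
  have hcard : Multiset.card (P s).roots = M := by
    rw [splits_iff_card_roots.1 (IsAlgClosed.splits (P s)), hd]
  have hmem : ∀ x ∈ (P s).roots, r ≤ ‖w - x‖ := fun x hx => by
    rw [← dist_eq_norm, dist_comm]
    exact hcon x (isRoot_of_mem_roots hx)
  have key : ∀ S : Multiset ℂ, (∀ x ∈ S, r ≤ ‖w - x‖) →
      r ^ Multiset.card S ≤ ‖(S.map (w - ·)).prod‖ := by
    intro S
    induction S using Multiset.induction with
    | empty => simp
    | cons a S ih =>
      intro h
      rw [Multiset.card_cons, Multiset.map_cons, Multiset.prod_cons, norm_mul, pow_succ']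
      exact mul_le_mul (h a (Multiset.mem_cons_self a S))
        (ih fun x hx => h x (Multiset.mem_cons_of_mem hx)) (by positivity) (norm_nonneg _)
  have := key _ hmem
  rwa [hcard] at this

theorem sum_rootMultiplicity_eq {p : ℂ[X]} :
    ∑ w ∈ p.roots.toFinset, p.rootMultiplicity w = p.natDegree := by
  rw [← splits_iff_card_roots.1 (IsAlgClosed.splits p), ← Multiset.toFinset_sum_count_eq]
  simp only [count_roots]

theorem eventually_roots_bijOn {T : Type*} [TopologicalSpace T] {M : ℕ} {P : T → ℂ[X]}
    (hm : ∀ s, (P s).Monic) (hd : ∀ s, (P s).natDegree = M) {s₀ : T}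
    (hc : ∀ i, ContinuousAt (fun s => (P s).coeff i) s₀)
    (hn : ∀ᶠ s in 𝓝 s₀, (P s).roots.toFinset.card = (P s₀).roots.toFinset.card) :
    ∀ᶠ r in 𝓝[>] (0 : ℝ), ∀ᶠ s in 𝓝 s₀,
      (∀ w', (P s).IsRoot w' → ∃ w, (P s₀).IsRoot w ∧ dist w' w < r) ∧
      ∀ w, (P s₀).IsRoot w → ∃ w', (P s).IsRoot w' ∧ dist w' w < r ∧
        (∀ w'', (P s).IsRoot w'' → dist w'' w < r → w'' = w') ∧
        (P s).rootMultiplicity w' = (P s₀).rootMultiplicity w := by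
  classical
  have hroot : ∀ s w, w ∈ (P s).roots.toFinset ↔ (P s).IsRoot w := fun s w => by
    rw [Multiset.mem_toFinset, mem_roots (hm s).ne_zero]
  have hsep : ∀ᶠ r in 𝓝[>] (0 : ℝ), ∀ w₁ ∈ (P s₀).roots.toFinset, ∀ w₂ ∈ (P s₀).roots.toFinset,
      w₁ ≠ w₂ → 2 * r < dist w₁ w₂ := by
    refine (Filter.eventually_all_finset _).2 fun w₁ _ =>
      (Filter.eventually_all_finset _).2 fun w₂ _ => ?_
    by_cases h : w₁ = w₂
    · simp [h]
    · have : Tendsto (fun r : ℝ => 2 * r) (𝓝[>] 0) (𝓝 0) :=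
        tendsto_nhdsWithin_of_tendsto_nhds ((continuous_const.mul continuous_id).tendsto' _ _ (by simp))
      filter_upwards [this.eventually (gt_mem_nhds (dist_pos.2 h))] with r hr _ using hr
  have hmult : ∀ᶠ r in 𝓝[>] (0 : ℝ), ∀ w ∈ (P s₀).roots.toFinset, ∀ᶠ s in 𝓝 s₀,
      ∀ w', dist w' w < r → (P s).rootMultiplicity w' ≤ (P s₀).rootMultiplicity w := by
    refine (Filter.eventually_all_finset _).2 fun w _ => ?_
    have h1 := (continuousAt_eval_iterate_derivative hd hc ((P s₀).rootMultiplicity w) w).eventually_ne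
      (iterate_derivative_rootMultiplicity_ne_zero (hm s₀).ne_zero w)
    rw [nhds_prod_eq, Filter.eventually_prod_iff] at h1
    obtain ⟨pa, hpa, pb, hpb, hab⟩ := h1
    obtain ⟨δ, hδ, hδb⟩ := Metric.eventually_nhds_iff.1 hpb
    filter_upwards [Ioo_mem_nhdsGT hδ] with r hr
    filter_upwards [hpa] with s hs w' hw'
    by_contra! hlt
    exact hab hs (hδb (hw'.trans hr.2)) (isRoot_iterate_derivative_of_lt_rootMultiplicity hlt)
  filter_upwards [hsep, hmult, self_mem_nhdsWithin] with r hsep hmult hr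
  have hnear : ∀ᶠ s in 𝓝 s₀, ∀ w ∈ (P s₀).roots.toFinset, ∃ w', (P s).IsRoot w' ∧ dist w' w < r :=
    (Filter.eventually_all_finset _).2 fun w hw =>
      eventually_exists_isRoot_dist_lt hm hd hc ((hroot _ _).1 hw) hr
  filter_upwards [hnear, (Filter.eventually_all_finset _).2 hmult, hn] with s hnear hmult hn
  choose! f hf hfd using hnear
  have hinj : Set.InjOn f (P s₀).roots.toFinset := by
    intro a ha b hb hab
    by_contra hne
    have h1 := hsep a ha b hb hne
    have h2 := dist_triangle_left a b (f a)
    have h3 := hfd a ha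
    have h4 := hfd b hb
    rw [← hab] at h4
    linarith
  have himg : (P s₀).roots.toFinset.image f = (P s).roots.toFinset := by
    refine Finset.eq_of_subset_of_card_le ?_ ?_
    · intro x hx
      obtain ⟨w, hw, rfl⟩ := Finset.mem_image.1 hx
      exact (hroot _ _).2 (hf w hw)
    · rw [Finset.card_image_of_injOn hinj, hn]
  have hcover : ∀ w', (P s).IsRoot w' → ∃ w ∈ (P s₀).roots.toFinset, f w = w' := fun w' hw' => by
    have : w' ∈ (P s₀).roots.toFinset.image f := by rw [himg]; exact (hroot _ _).2 hw'
    simpa using this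
  have hsum : ∑ w ∈ (P s₀).roots.toFinset, (P s).rootMultiplicity (f w) =
      ∑ w ∈ (P s₀).roots.toFinset, (P s₀).rootMultiplicity w := by
    rw [sum_rootMultiplicity_eq, hd, ← hd s, ← sum_rootMultiplicity_eq, ← himg,
      Finset.sum_image hinj]
  have heq := (Finset.sum_eq_sum_iff_of_le fun w hw => hmult w hw (f w) (hfd w hw)).1 hsum
  refine ⟨fun w' hw' => ?_, fun w hw => ⟨f w, hf w ((hroot _ _).2 hw), hfd w ((hroot _ _).2 hw),
    fun w'' hw'' hd'' => ?_, heq w ((hroot _ _).2 hw)⟩⟩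
  · obtain ⟨w, hw, rfl⟩ := hcover w' hw'
    exact ⟨w, (hroot _ _).1 hw, hfd w hw⟩
  · obtain ⟨v, hv, rfl⟩ := hcover w'' hw''
    congr 1
    by_contra hne
    have h1 := hsep v hv w ((hroot _ _).2 hw) hne
    have h2 := dist_triangle_left v w (f v)
    have h3 := hfd v hv
    have hr' : (0 : ℝ) < r := hr
    linarith

theorem isRoot_map_ofReal {p : ℝ[X]} {x : ℝ} :
    (p.map (algebraMap ℝ ℂ)).IsRoot (x : ℂ) ↔ p.IsRoot x := by
  rw [IsRoot.def, IsRoot.def, ← Complex.coe_algebraMap, eval_map_algebraMap, aeval_algebraMap_apply]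
  simp

theorem isRoot_map_conj {p : ℝ[X]} {w : ℂ} (hw : (p.map (algebraMap ℝ ℂ)).IsRoot w) :
    (p.map (algebraMap ℝ ℂ)).IsRoot (starRingEnd ℂ w) := by
  rw [IsRoot.def, eval_map_algebraMap] at hw ⊢
  have := aeval_algHom_apply (Complex.conjAe : ℂ →ₐ[ℝ] ℂ) w p
  rw [hw, map_zero] at this
  exact this

theorem eventually_real_roots_bijOn {T : Type*} [TopologicalSpace T] {M : ℕ} {q : T → ℝ[X]}
    (hm : ∀ s, (q s).Monic) (hd : ∀ s, (q s).natDegree = M) {s₀ : T}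
    (hc : ∀ i, ContinuousAt (fun s => (q s).coeff i) s₀)
    (hn : ∀ᶠ s in 𝓝 s₀, ((q s).map (algebraMap ℝ ℂ)).roots.toFinset.card =
      ((q s₀).map (algebraMap ℝ ℂ)).roots.toFinset.card) :
    ∀ᶠ r in 𝓝[>] (0 : ℝ), ∀ᶠ s in 𝓝 s₀, ∃ f : ℝ → ℝ,
      (q s).roots.toFinset = (q s₀).roots.toFinset.image f ∧ ∀ x ∈ (q s₀).roots.toFinset,
        dist (f x) x < r ∧ (q s).rootMultiplicity (f x) = (q s₀).rootMultiplicity x := by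
  classical
  have hroot : ∀ s w, w ∈ (q s).roots.toFinset ↔ (q s).IsRoot w := fun s w => by
    rw [Multiset.mem_toFinset, mem_roots (hm s).ne_zero]
  have him : ∀ᶠ r in 𝓝[>] (0 : ℝ), ∀ w ∈ ((q s₀).map (algebraMap ℝ ℂ)).roots.toFinset,
      w.im ≠ 0 → r < |w.im| := by
    refine (Filter.eventually_all_finset _).2 fun w _ => ?_
    by_cases h : w.im = 0
    · simp [h]
    · filter_upwards [Ioo_mem_nhdsGT (abs_pos.2 h)] with r hr _ using hr.2
  have hmain := eventually_roots_bijOn (P := fun s => (q s).map (algebraMap ℝ ℂ))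
    (fun s => (hm s).map _) (fun s => by rw [(hm s).natDegree_map, hd s])
    (fun i => by
      simp only [coeff_map, Complex.coe_algebraMap]
      exact Complex.continuous_ofReal.continuousAt.comp (hc i)) hn
  filter_upwards [hmain, him] with r hmain him
  filter_upwards [hmain] with s ⟨h1, h2⟩
  have h3 : ∀ x ∈ (q s₀).roots.toFinset, ∃ x', (q s).IsRoot x' ∧ dist x' x < r ∧
      (∀ x'', (q s).IsRoot x'' → dist x'' x < r → x'' = x') ∧
      (q s).rootMultiplicity x' = (q s₀).rootMultiplicity x := by
    intro x hx
    obtain ⟨w, hw, hwd, hwu, hwm⟩ := h2 (x : ℂ) (isRoot_map_ofReal.2 ((hroot _ _).1 hx))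
    have hconj : starRingEnd ℂ w = w := by
      refine hwu _ (isRoot_map_conj hw) ?_
      rw [← Complex.conj_ofReal x, Complex.dist_conj_conj]
      exact hwd
    obtain ⟨x', rfl⟩ := Complex.conj_eq_iff_real.1 hconj
    refine ⟨x', isRoot_map_ofReal.1 hw, by rwa [Complex.isometry_ofReal.dist_eq] at hwd, fun x'' hx'' hd'' => ?_, ?_⟩
    · exact Complex.ofReal_injective
        (hwu x'' (isRoot_map_ofReal.2 hx'') (by rwa [Complex.isometry_ofReal.dist_eq]))
    · rw [eq_rootMultiplicity_map (algebraMap ℝ ℂ).injective, Complex.coe_algebraMap,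
        eq_rootMultiplicity_map (algebraMap ℝ ℂ).injective x, Complex.coe_algebraMap]
      exact hwm
  choose! f hf hfd hfu hfm using h3
  refine ⟨f, ?_, fun x hx => ⟨hfd x hx, hfm x hx⟩⟩
  ext x'
  rw [Finset.mem_image, hroot]
  constructor
  · intro hx'
    obtain ⟨w, hw, hwd⟩ := h1 x' (isRoot_map_ofReal.2 hx')
    have hwim : w.im = 0 := by
      by_contra hne
      have h4 := him w (by
        rw [Multiset.mem_toFinset, mem_roots ((hm s₀).map _).ne_zero]
        exact hw) hne
      have h5 := Complex.abs_im_le_norm ((x' : ℂ) - w)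
      rw [← dist_eq_norm, Complex.sub_im, Complex.ofReal_im, zero_sub, abs_neg] at h5
      linarith
    obtain ⟨x, rfl⟩ : ∃ x : ℝ, (x : ℂ) = w := ⟨w.re, Complex.ext rfl (by simp [hwim])⟩
    rw [Complex.isometry_ofReal.dist_eq] at hwd
    have hx : x ∈ (q s₀).roots.toFinset := (hroot _ _).2 (isRoot_map_ofReal.1 hw)
    exact ⟨x, hx, (hfu x hx x' hx' hwd).symm⟩
  · rintro ⟨x, hx, rfl⟩
    exact hf x hx

theorem exists_continuous_ordered_roots {T : Type*} [TopologicalSpace T] [PreconnectedSpace T]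
    [Nonempty T] {M : ℕ} {q : T → ℝ[X]}
    (hm : ∀ s, (q s).Monic) (hd : ∀ s, (q s).natDegree = M)
    (hc : ∀ i, Continuous (fun s => (q s).coeff i))
    (hn : ∀ s s', ((q s).map (algebraMap ℝ ℂ)).roots.toFinset.card =
      ((q s').map (algebraMap ℝ ℂ)).roots.toFinset.card) :
    ∃ (N : ℕ) (ξ : Fin N → T → ℝ) (μ : Fin N → ℕ), (∀ i, Continuous (ξ i)) ∧
      (∀ s, StrictMono fun i => ξ i s) ∧ (∀ s x, (q s).IsRoot x ↔ ∃ i, ξ i s = x) ∧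
      ∀ s i, (q s).rootMultiplicity (ξ i s) = μ i := by
  classical
  have hroot : ∀ s w, w ∈ (q s).roots.toFinset ↔ (q s).IsRoot w := fun s w => by
    rw [Multiset.mem_toFinset, mem_roots (hm s).ne_zero]
  have hloc : ∀ s₀, ∀ᶠ r in 𝓝[>] (0 : ℝ), ∀ᶠ s in 𝓝 s₀, ∃ f : ℝ → ℝ,
      StrictMonoOn f (q s₀).roots.toFinset ∧ (q s).roots.toFinset = (q s₀).roots.toFinset.image f ∧
      ∀ x ∈ (q s₀).roots.toFinset,
        dist (f x) x < r ∧ (q s).rootMultiplicity (f x) = (q s₀).rootMultiplicity x := by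
    intro s₀
    have hsep : ∀ᶠ r in 𝓝[>] (0 : ℝ), ∀ w₁ ∈ (q s₀).roots.toFinset, ∀ w₂ ∈ (q s₀).roots.toFinset,
        w₁ < w₂ → 2 * r < w₂ - w₁ := by
      refine (Filter.eventually_all_finset _).2 fun w₁ _ =>
        (Filter.eventually_all_finset _).2 fun w₂ _ => ?_
      by_cases h : w₁ < w₂
      · have : Tendsto (fun r : ℝ => 2 * r) (𝓝[>] 0) (𝓝 0) :=
          tendsto_nhdsWithin_of_tendsto_nhds
            ((continuous_const.mul continuous_id).tendsto' _ _ (by simp))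
        filter_upwards [this.eventually (gt_mem_nhds (sub_pos.2 h))] with r hr _ using hr
      · simp [h]
    filter_upwards [hsep, eventually_real_roots_bijOn hm hd (fun i => (hc i).continuousAt)
      (Filter.Eventually.of_forall fun s => hn s s₀)] with r hsep hr
    filter_upwards [hr] with s ⟨f, hf, hfd⟩
    refine ⟨f, fun x hx y hy hxy => ?_, hf, hfd⟩
    have h1 := hsep x hx y hy hxy
    have h2 := abs_lt.1 (hfd x hx).1
    have h3 := abs_lt.1 (hfd y hy).1
    linarith
  have hcard : ∀ s s', (q s).roots.toFinset.card = (q s').roots.toFinset.card := by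
    refine fun s s' => IsLocallyConstant.apply_eq_of_preconnectedSpace
      (f := fun s => (q s).roots.toFinset.card) ?_ s s'
    refine (IsLocallyConstant.iff_eventually_eq _).2 fun s₀ => ?_
    obtain ⟨r, hr⟩ := (hloc s₀).exists
    filter_upwards [hr] with s ⟨f, hf, hfi, _⟩
    rw [hfi, Finset.card_image_of_injOn hf.injOn]
  obtain ⟨s₁⟩ := ‹Nonempty T›
  set N := (q s₁).roots.toFinset.card with hN
  let ξ : Fin N → T → ℝ := fun i s => (q s).roots.toFinset.orderEmbOfFin (hcard s s₁) i
  have hξmem : ∀ s i, ξ i s ∈ (q s).roots.toFinset := fun s i => Finset.orderEmbOfFin_mem _ _ _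
  have hξloc : ∀ s₀, ∀ᶠ r in 𝓝[>] (0 : ℝ), ∀ᶠ s in 𝓝 s₀, ∀ i, dist (ξ i s) (ξ i s₀) < r ∧
      (q s).rootMultiplicity (ξ i s) = (q s₀).rootMultiplicity (ξ i s₀) := by
    intro s₀
    filter_upwards [hloc s₀] with r hr
    filter_upwards [hr] with s ⟨f, hf, hfi, hfd⟩ i
    have huniq := Finset.orderEmbOfFin_unique (hcard s s₁) (f := fun i => f (ξ i s₀))
      (fun i => by rw [hfi]; exact Finset.mem_image_of_mem _ (hξmem s₀ i))
      (fun i j hij => hf (hξmem s₀ i) (hξmem s₀ j)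
        (((q s₀).roots.toFinset.orderEmbOfFin (hcard s₀ s₁)).strictMono hij))
    have : ξ i s = f (ξ i s₀) := (congrFun huniq i).symm
    rw [this]
    exact hfd _ (hξmem s₀ i)
  refine ⟨N, ξ, fun i => (q s₁).rootMultiplicity (ξ i s₁), fun i => ?_, fun s =>
    ((q s).roots.toFinset.orderEmbOfFin (hcard s s₁)).strictMono, fun s x => ?_, fun s i => ?_⟩
  · rw [continuous_iff_continuousAt]
    intro s₀
    rw [Metric.continuousAt_iff']
    intro ε hε
    obtain ⟨r, hr, hrε⟩ := ((hξloc s₀).and (Ioo_mem_nhdsGT hε)).exists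
    filter_upwards [hr] with s hs using (hs i).1.trans hrε.2
  · rw [← hroot, ← Finset.mem_coe, ← Finset.range_orderEmbOfFin _ (hcard s s₁)]
    rfl
  · refine IsLocallyConstant.apply_eq_of_preconnectedSpace
      (f := fun s => (q s).rootMultiplicity (ξ i s)) ?_ s s₁
    refine (IsLocallyConstant.iff_eventually_eq _).2 fun s₀ => ?_
    obtain ⟨r, hr⟩ := (hξloc s₀).exists
    filter_upwards [hr] with s hs using (hs i).2

end Polynomial

theorem AnalyticAt.of_implicit {E : Type*} [NormedAddCommGroup E] [NormedSpace ℝ E]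
    [CompleteSpace E] {F : E × ℝ → ℝ} {ξ : E → ℝ} {s₀ : E} (hF : AnalyticAt ℝ F (s₀, ξ s₀))
    (hξ : ContinuousAt ξ s₀) (h0 : ∀ᶠ s in 𝓝 s₀, F (s, ξ s) = 0)
    (hd : deriv (fun x => F (s₀, x)) (ξ s₀) ≠ 0) : AnalyticAt ℝ ξ s₀ := by
  set F' := fderiv ℝ F (s₀, ξ s₀) with hF'
  have hFd : HasFDerivAt F F' (s₀, ξ s₀) := hF.differentiableAt.hasFDerivAt
  set c := F' (0, 1) with hc
  have hc0 : c ≠ 0 := by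
    have h1 : HasDerivAt (fun x : ℝ => (s₀, x)) ((0 : E), (1 : ℝ)) (ξ s₀) :=
      (hasDerivAt_const _ _).prodMk (hasDerivAt_id _)
    have := hFd.comp_hasDerivAt (ξ s₀) h1
    rwa [show deriv (fun x => F (s₀, x)) (ξ s₀) = c from this.deriv] at hd
  have hlin : ∀ w : E × ℝ, F' w = F' (w.1, 0) + w.2 * c := by
    intro w
    rw [hc, ← smul_eq_mul, ← map_smul, ← map_add]
    congr 1
    ext <;> simp
  let e : (E × ℝ) ≃L[ℝ] (E × ℝ) := ContinuousLinearEquiv.equivOfInverse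
    ((ContinuousLinearMap.fst ℝ E ℝ).prod F')
    ((ContinuousLinearMap.fst ℝ E ℝ).prod (c⁻¹ • (ContinuousLinearMap.snd ℝ E ℝ -
      F'.comp ((ContinuousLinearMap.inl ℝ E ℝ).comp (ContinuousLinearMap.fst ℝ E ℝ)))))
    (fun w => by
      refine Prod.ext rfl ?_
      simp only [ContinuousLinearMap.prod_apply, smul_apply, sub_apply,
        ContinuousLinearMap.coe_snd', ContinuousLinearMap.coe_fst', ContinuousLinearMap.comp_apply,
        ContinuousLinearMap.inl_apply, hlin w, smul_eq_mul]
      field_simp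
      ring)
    (fun w => by
      refine Prod.ext rfl ?_
      simp only [ContinuousLinearMap.prod_apply, smul_apply, sub_apply,
        ContinuousLinearMap.coe_snd', ContinuousLinearMap.coe_fst', ContinuousLinearMap.comp_apply,
        ContinuousLinearMap.inl_apply, smul_eq_mul]
      rw [hlin]
      field_simp
      ring)
  let G : E × ℝ → E × ℝ := fun w => (w.1, F w)
  have hG : HasFDerivAt G (e : (E × ℝ) →L[ℝ] (E × ℝ)) (s₀, ξ s₀) := hasFDerivAt_fst.prodMk hFd
  have hGa : AnalyticAt ℝ G (s₀, ξ s₀) := analyticAt_fst.prod hF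
  have hGc : ContDiffAt ℝ ⊤ G (s₀, ξ s₀) := hGa.contDiffAt
  let Ψ := hGc.localInverse hG (by simp)
  have hG0 : G (s₀, ξ s₀) = (s₀, 0) := by simp [G, h0.self_of_nhds]
  have hΨa : AnalyticAt ℝ Ψ (s₀, 0) := by
    have := (hGc.to_localInverse hG (by simp)).analyticAt
    rwa [hG0] at this
  have hΨl : ∀ᶠ y in 𝓝 (s₀, ξ s₀), Ψ (G y) = y :=
    (hGc.hasStrictFDerivAt' hG (by simp)).eventually_left_inverse
  have hcurve : Tendsto (fun s => (s, ξ s)) (𝓝 s₀) (𝓝 (s₀, ξ s₀)) :=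
    (continuousAt_id.prodMk hξ)
  have hΨs : AnalyticAt ℝ (fun s => Ψ (s, 0)) s₀ :=
    AnalyticAt.fun_comp (g := Ψ) (f := fun s : E => (s, (0 : ℝ))) hΨa
      (analyticAt_id.prod analyticAt_const)
  have hmain : AnalyticAt ℝ (fun s => (Ψ (s, 0)).2) s₀ :=
    AnalyticAt.fun_comp (g := Prod.snd) analyticAt_snd hΨs
  refine hmain.congr ?_
  filter_upwards [hcurve.eventually hΨl, h0] with s hs h0
  simp only [G, h0] at hs
  rw [hs]

theorem Polynomial.exists_analytic_ordered_roots {E : Type*} [NormedAddCommGroup E]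
    [NormedSpace ℝ E] [CompleteSpace E] {O : Set E} (hO : IsOpen O) (hOc : IsPreconnected O)
    (hOn : O.Nonempty) {M : ℕ} {q : E → Polynomial ℝ} (hm : ∀ s, (q s).Monic)
    (hd : ∀ s, (q s).natDegree = M) (hc : ∀ i, AnalyticOnNhd ℝ (fun s => (q s).coeff i) O)
    (hn : ∀ s ∈ O, ∀ s' ∈ O, ((q s).map (algebraMap ℝ ℂ)).roots.toFinset.card =
      ((q s').map (algebraMap ℝ ℂ)).roots.toFinset.card) :
    ∃ (N : ℕ) (ξ : Fin N → E → ℝ), (∀ i, AnalyticOnNhd ℝ (ξ i) O) ∧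
      (∀ s ∈ O, StrictMono fun i => ξ i s) ∧ ∀ s ∈ O, ∀ x, (q s).IsRoot x ↔ ∃ i, ξ i s = x := by
  have : PreconnectedSpace O := isPreconnected_iff_preconnectedSpace.1 hOc
  have : Nonempty O := hOn.to_subtype
  obtain ⟨N, ξ, μ, h1, h2, h3, h4⟩ := exists_continuous_ordered_roots (T := O)
    (q := fun s => q s) (fun s => hm s) (fun s => hd s)
    (fun i => continuousOn_iff_continuous_domRestrict.1 (hc i).continuousOn)
    (fun s s' => hn s s.2 s' s'.2)
  classical
  let η : Fin N → E → ℝ := fun i s => if hs : s ∈ O then ξ i ⟨s, hs⟩ else 0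
  have hη : ∀ i s (hs : s ∈ O), η i s = ξ i ⟨s, hs⟩ := fun i s hs => dif_pos hs
  have hηc : ∀ i, ContinuousOn (η i) O := by
    intro i
    rw [continuousOn_iff_continuous_domRestrict]
    convert h1 i using 1
    funext s
    exact hη i s s.2
  refine ⟨N, η, fun i s hs => ?_, fun s hs => ?_, fun s hs x => ?_⟩
  · have hroot : ∀ s ∈ O, (q s).IsRoot (η i s) := fun s hs => by
      rw [hη i s hs]; exact (h3 ⟨s, hs⟩ _).2 ⟨i, rfl⟩
    have hμ : ∀ s ∈ O, (q s).rootMultiplicity (η i s) = μ i := fun s hs => by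
      rw [hη i s hs]; exact h4 ⟨s, hs⟩ i
    have hμpos : 0 < μ i := by
      rw [← hμ s hs]; exact (rootMultiplicity_pos (hm s).ne_zero).2 (hroot s hs)
    refine AnalyticAt.of_implicit (F := fun y => (derivative^[μ i - 1] (q y.1)).eval y.2) ?_
      ((hηc i).continuousAt (hO.mem_nhds hs)) ?_ ?_
    · simp only [fun y : E × ℝ => eval_iterate_derivative_eq_sum (hd y.1) (μ i - 1) y.2,
        nsmul_eq_mul]
      refine Finset.analyticAt_fun_sum _ fun j _ => ?_
      refine AnalyticAt.mul (analyticAt_const.mul ?_) (analyticAt_snd.pow _)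
      exact AnalyticAt.fun_comp (g := fun s => (q s).coeff (j + (μ i - 1))) (f := Prod.fst)
        (hc _ s hs) analyticAt_fst
    · filter_upwards [hO.mem_nhds hs] with s hs
      exact isRoot_iterate_derivative_of_lt_rootMultiplicity (by rw [hμ s hs]; omega)
    · dsimp only
      rw [Polynomial.deriv, ← Function.iterate_succ_apply' derivative, Nat.succ_eq_add_one,
        Nat.sub_add_cancel hμpos, ← hμ s hs]
      exact iterate_derivative_rootMultiplicity_ne_zero (hm s).ne_zero _
  · simp only [hη _ s hs]
    exact h2 ⟨s, hs⟩
  · simp only [hη _ s hs]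
    exact h3 ⟨s, hs⟩ x

theorem Polynomial.exists_analytic_ordered_roots_of_prod {E : Type*} [NormedAddCommGroup E]
    [NormedSpace ℝ E] [CompleteSpace E] {O : Set E} (hO : IsOpen O) (hOc : IsPreconnected O)
    (hOn : O.Nonempty) {ι : Type*} [Fintype ι] {m : ι → ℕ} {M : ℕ} {p : ι → E → Polynomial ℝ}
    {q : E → Polynomial ℝ} (hq : ∀ s, q s = ∏ l, p l s)
    (hmp : ∀ l s, (p l s).Monic) (hdp : ∀ l s, (p l s).natDegree = m l)
    (hcp : ∀ l i, AnalyticOnNhd ℝ (fun s => (p l s).coeff i) O)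
    (hnp : ∀ l, ∀ s ∈ O, ∀ s' ∈ O, ((p l s).map (algebraMap ℝ ℂ)).roots.toFinset.card =
      ((p l s').map (algebraMap ℝ ℂ)).roots.toFinset.card)
    (hm : ∀ s, (q s).Monic)
    (hd : ∀ s, (q s).natDegree = M) (hc : ∀ i, AnalyticOnNhd ℝ (fun s => (q s).coeff i) O)
    (hn : ∀ s ∈ O, ∀ s' ∈ O, ((q s).map (algebraMap ℝ ℂ)).roots.toFinset.card =
      ((q s').map (algebraMap ℝ ℂ)).roots.toFinset.card) :
    ∃ (N : ℕ) (ξ : Fin N → E → ℝ), (∀ i, AnalyticOnNhd ℝ (ξ i) O) ∧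
      (∀ s ∈ O, StrictMono fun i => ξ i s) ∧ (∀ s ∈ O, ∀ x, (q s).IsRoot x ↔ ∃ i, ξ i s = x) ∧
      ∀ l i, (∀ s ∈ O, (p l s).IsRoot (ξ i s)) ∨ ∀ s ∈ O, ¬ (p l s).IsRoot (ξ i s) := by
  obtain ⟨N, ξ, h1, h2, h3⟩ := exists_analytic_ordered_roots hO hOc hOn hm hd hc hn
  refine ⟨N, ξ, h1, h2, h3, fun l => ?_⟩
  obtain ⟨N', ζ, k1, k2, k3⟩ := exists_analytic_ordered_roots hO hOc hOn (hmp l) (hdp l) (hcp l)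
    (hnp l)
  have : PreconnectedSpace O := isPreconnected_iff_preconnectedSpace.1 hOc
  have hcov : ∀ j, ∀ s ∈ O, ∃ i, ξ i s = ζ j s := by
    intro j s hs
    rw [← h3 s hs, hq, ← dvd_iff_isRoot]
    exact (dvd_iff_isRoot.2 ((k3 s hs _).2 ⟨j, rfl⟩)).trans
      (Finset.dvd_prod_of_mem (fun l => p l s) (Finset.mem_univ l))
  have hclosed : ∀ i j, IsClosed {s : O | ξ i s = ζ j s} := fun i j =>
    isClosed_eq (continuousOn_iff_continuous_domRestrict.1 (h1 i).continuousOn)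
      (continuousOn_iff_continuous_domRestrict.1 (k1 j).continuousOn)
  have hclopen : ∀ i j, IsClopen {s : O | ξ i s = ζ j s} := by
    intro i j
    refine ⟨hclosed i j, ?_⟩
    have : {s : O | ξ i s = ζ j s}ᶜ = ⋃ i' ∈ {i' | i' ≠ i}, {s : O | ξ i' s = ζ j s} := by
      ext s
      simp only [mem_compl_iff, mem_ofPred_eq, mem_iUnion, exists_prop]
      constructor
      · intro h
        obtain ⟨i', hi'⟩ := hcov j s s.2
        exact ⟨i', fun h' => h (h' ▸ hi'), hi'⟩
      · rintro ⟨i', hne, hi'⟩ h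
        exact hne ((h2 s s.2).injective (hi'.trans h.symm))
    rw [← isClosed_compl_iff, this]
    exact (Set.toFinite _).isClosed_biUnion fun i' _ => hclosed i' j
  intro i
  by_cases hex : ∃ j, {s : O | ξ i s = ζ j s} = univ
  · obtain ⟨j, hj⟩ := hex
    refine Or.inl fun s hs => (k3 s hs _).2 ⟨j, ?_⟩
    have : (⟨s, hs⟩ : O) ∈ {s : O | ξ i s = ζ j s} := by rw [hj]; exact mem_univ _
    exact this.symm
  · push Not at hex
    refine Or.inr fun s hs hroot => ?_
    obtain ⟨j, hj⟩ := (k3 s hs _).1 hroot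
    rcases isClopen_iff.1 (hclopen i j) with h | h
    · have : (⟨s, hs⟩ : O) ∈ {s : O | ξ i s = ζ j s} := hj.symm
      rw [h] at this
      exact this
    · exact hex j h

/-- An analytic cell of dimension `k`: the image of a nonempty connected open subset of `ℝ^k`
under an analytic map with a continuous linear left inverse. -/
def IsAnalyticCell {E : Type*} [NormedAddCommGroup E] [NormedSpace ℝ E] (k : ℕ) (C : Set E) :
    Prop :=
  ∃ (O : Set (Fin k → ℝ)) (φ : (Fin k → ℝ) → E) (π : E →L[ℝ] (Fin k → ℝ)),
    IsOpen O ∧ IsPreconnected O ∧ O.Nonempty ∧ AnalyticOnNhd ℝ φ O ∧ (∀ t ∈ O, π (φ t) = t) ∧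
      C = φ '' O

namespace IsAnalyticCell

variable {E F : Type*} [NormedAddCommGroup E] [NormedSpace ℝ E] [NormedAddCommGroup F]
  [NormedSpace ℝ F]

theorem image {k : ℕ} {C : Set E} (hC : IsAnalyticCell k C) (L : E ≃L[ℝ] F) :
    IsAnalyticCell k (L '' C) := by
  obtain ⟨O, φ, π, hO, hOc, hOn, hφ, hπ, rfl⟩ := hC
  refine ⟨O, fun t => L (φ t), π.comp (L.symm : F →L[ℝ] E), hO, hOc, hOn, fun t ht => ?_,
    fun t ht => by simp [hπ t ht], by rw [image_image]⟩
  exact (L.toContinuousLinearMap.analyticAt _).fun_comp (hφ t ht)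

end IsAnalyticCell

theorem AnalyticAt.finCons {E : Type*} [NormedAddCommGroup E] [NormedSpace ℝ E] {n : ℕ}
    {f : E → ℝ} {φ : E → Fin n → ℝ} {x : E} (hf : AnalyticAt ℝ f x) (hφ : AnalyticAt ℝ φ x) :
    AnalyticAt ℝ (fun s => (Fin.cons (f s) (φ s) : Fin (n + 1) → ℝ)) x := by
  rw [analyticAt_pi_iff] at hφ ⊢
  intro i
  refine Fin.cases ?_ (fun j => ?_) i
  · simpa using hf
  · simpa using hφ j

theorem analyticAt_finTail {n : ℕ} (y : Fin (n + 1) → ℝ) :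
    AnalyticAt ℝ (fun y : Fin (n + 1) → ℝ => Fin.tail y) y := by
  rw [analyticAt_pi_iff]
  intro i
  exact (ContinuousLinearMap.proj (R := ℝ) (φ := fun _ : Fin (n + 1) => ℝ) i.succ).analyticAt y

theorem isAnalyticCell_graph {n k : ℕ} {O : Set (Fin k → ℝ)} {φ : (Fin k → ℝ) → Fin n → ℝ}
    {π : (Fin n → ℝ) →L[ℝ] (Fin k → ℝ)} (hO : IsOpen O) (hOc : IsPreconnected O)
    (hOn : O.Nonempty) (hφ : AnalyticOnNhd ℝ φ O) (hπ : ∀ t ∈ O, π (φ t) = t)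
    {a : (Fin k → ℝ) → ℝ} (ha : AnalyticOnNhd ℝ a O) :
    IsAnalyticCell k ((fun s => (Fin.cons (a s) (φ s) : Fin (n + 1) → ℝ)) '' O) := by
  refine ⟨O, _, π.comp (ContinuousLinearMap.pi fun i : Fin n =>
    ContinuousLinearMap.proj (R := ℝ) (φ := fun _ : Fin (n + 1) => ℝ) i.succ),
    hO, hOc, hOn, fun s hs => (ha s hs).finCons (hφ s hs), fun s hs => ?_, rfl⟩
  refine Eq.trans (congrArg π ?_) (hπ s hs)
  ext i
  simp

theorem isAnalyticCell_band {n k : ℕ} {O : Set (Fin k → ℝ)} {φ : (Fin k → ℝ) → Fin n → ℝ}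
    {π : (Fin n → ℝ) →L[ℝ] (Fin k → ℝ)} (hO : IsOpen O) (hOc : IsPreconnected O)
    (hOn : O.Nonempty) (hφ : AnalyticOnNhd ℝ φ O) (hπ : ∀ t ∈ O, π (φ t) = t)
    {a b : (Fin k → ℝ) → ℝ} (ha : AnalyticOnNhd ℝ a O) (hb : AnalyticOnNhd ℝ b O)
    (hab : ∀ s ∈ O, a s < b s) :
    IsAnalyticCell (k + 1) ((fun u : Fin (k + 1) → ℝ =>
      (Fin.cons (u 0) (φ (Fin.tail u)) : Fin (n + 1) → ℝ)) ''
        {u | Fin.tail u ∈ O ∧ a (Fin.tail u) < u 0 ∧ u 0 < b (Fin.tail u)}) := by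
  have htail : Continuous (fun u : Fin (k + 1) → ℝ => (Fin.tail u : Fin k → ℝ)) :=
    continuous_pi fun i => continuous_apply _
  have h0 : Continuous (fun u : Fin (k + 1) → ℝ => u 0) := continuous_apply 0
  have hTo : IsOpen ((fun u : Fin (k + 1) → ℝ => (Fin.tail u : Fin k → ℝ)) ⁻¹' O) :=
    hO.preimage htail
  have hca : ContinuousOn (fun u : Fin (k + 1) → ℝ => a (Fin.tail u))
      ((fun u : Fin (k + 1) → ℝ => (Fin.tail u : Fin k → ℝ)) ⁻¹' O) :=
    ha.continuousOn.comp htail.continuousOn fun u hu => hu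
  have hcb : ContinuousOn (fun u : Fin (k + 1) → ℝ => b (Fin.tail u))
      ((fun u : Fin (k + 1) → ℝ => (Fin.tail u : Fin k → ℝ)) ⁻¹' O) :=
    hb.continuousOn.comp htail.continuousOn fun u hu => hu
  refine ⟨_, _, ContinuousLinearMap.pi (Fin.cases
    (ContinuousLinearMap.proj (R := ℝ) (φ := fun _ : Fin (n + 1) => ℝ) 0)
    fun j : Fin k => (ContinuousLinearMap.proj (R := ℝ) (φ := fun _ : Fin k => ℝ) j).comp
      (π.comp (ContinuousLinearMap.pi fun i : Fin n =>
        ContinuousLinearMap.proj (R := ℝ) (φ := fun _ : Fin (n + 1) => ℝ) i.succ))),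
    ?_, ?_, ?_, ?_, ?_, rfl⟩
  · have h1 := (h0.continuousOn.sub hca).isOpen_inter_preimage hTo (isOpen_Ioi (a := (0 : ℝ)))
    have h2 := (hcb.sub h0.continuousOn).isOpen_inter_preimage hTo (isOpen_Ioi (a := (0 : ℝ)))
    convert h1.inter h2 using 1
    ext u
    simp only [mem_ofPred_eq, mem_inter_iff, mem_preimage, mem_Ioi, sub_pos, Pi.sub_apply]
    tauto
  · have hpc : IsPreconnected (O ×ˢ Ioo (0 : ℝ) 1) := hOc.prod isPreconnected_Ioo
    have hcont : ContinuousOn (fun w : (Fin k → ℝ) × ℝ =>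
        (Fin.cons (a w.1 + w.2 * (b w.1 - a w.1)) w.1 : Fin (k + 1) → ℝ)) (O ×ˢ Ioo (0 : ℝ) 1) := by
      have h1 : ContinuousOn (fun w : (Fin k → ℝ) × ℝ => a w.1) (O ×ˢ Ioo (0 : ℝ) 1) :=
        ha.continuousOn.comp continuous_fst.continuousOn fun w hw => hw.1
      have h2 : ContinuousOn (fun w : (Fin k → ℝ) × ℝ => b w.1) (O ×ˢ Ioo (0 : ℝ) 1) :=
        hb.continuousOn.comp continuous_fst.continuousOn fun w hw => hw.1
      refine continuousOn_pi.2 fun i => ?_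
      refine Fin.cases ?_ (fun j => ?_) i
      · simp only [Fin.cons_zero]
        exact h1.add (continuous_snd.continuousOn.mul (h2.sub h1))
      · simp only [Fin.cons_succ]
        exact ((continuous_apply j).comp continuous_fst).continuousOn
    convert hpc.image _ hcont using 1
    ext u
    constructor
    · rintro ⟨hu, hau, hub⟩
      have hpos : 0 < b (Fin.tail u) - a (Fin.tail u) := by linarith
      refine ⟨(Fin.tail u, (u 0 - a (Fin.tail u)) / (b (Fin.tail u) - a (Fin.tail u))),
        ⟨hu, div_pos (by linarith) hpos, (div_lt_one hpos).2 (by linarith)⟩, ?_⟩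
      simp only
      rw [div_mul_cancel₀ _ hpos.ne', add_sub_cancel]
      exact Fin.cons_self_tail u
    · rintro ⟨⟨s, r⟩, ⟨hs, hr0, hr1⟩, rfl⟩
      have := hab s hs
      simp only at hs hr0 hr1 ⊢
      refine ⟨by simpa using hs, ?_, ?_⟩
      · simp only [Fin.tail_cons, Fin.cons_zero]
        nlinarith
      · simp only [Fin.tail_cons, Fin.cons_zero]
        nlinarith
  · obtain ⟨s, hs⟩ := hOn
    obtain ⟨t, h1, h2⟩ := exists_between (hab s hs)
    exact ⟨Fin.cons t s, by simpa using hs, by simpa using h1, by simpa using h2⟩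
  · rintro u ⟨hu, -, -⟩
    refine AnalyticAt.finCons ?_ ?_
    · exact (ContinuousLinearMap.proj (R := ℝ) (φ := fun _ : Fin (k + 1) => ℝ) 0).analyticAt u
    · exact AnalyticAt.fun_comp (g := φ) (hφ _ hu) (analyticAt_finTail u)
  · rintro u ⟨hu, -, -⟩
    ext i
    refine Fin.cases ?_ (fun j => ?_) i
    · simp
    · exact congrFun (hπ _ hu) j

theorem exists_cylinder_cover {n k : ℕ} {O : Set (Fin k → ℝ)} {φ : (Fin k → ℝ) → Fin n → ℝ}
    {π : (Fin n → ℝ) →L[ℝ] (Fin k → ℝ)} (hO : IsOpen O) (hOc : IsPreconnected O)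
    (hOn : O.Nonempty) (hφ : AnalyticOnNhd ℝ φ O) (hπ : ∀ t ∈ O, π (φ t) = t)
    {N : ℕ} {ξ : Fin N → (Fin k → ℝ) → ℝ} (hξ : ∀ i, AnalyticOnNhd ℝ (ξ i) O)
    (hmono : ∀ s ∈ O, StrictMono fun i => ξ i s) {ε : ℝ} {iₗ iᵤ : Fin N}
    (hl : ∀ s ∈ O, ξ iₗ s = -ε) (hu : ∀ s ∈ O, ξ iᵤ s = ε)
    {ι : Type*} {F : ι → (Fin (n + 1) → ℝ) → ℝ}
    (hF : ∀ l i, iₗ ≤ i → i ≤ iᵤ → (∀ s ∈ O, F l (Fin.cons (ξ i s) (φ s)) = 0) ∨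
      ∀ s ∈ O, F l (Fin.cons (ξ i s) (φ s)) ≠ 0)
    (hz : ∀ l, ∀ s ∈ O, ∀ t, |t| ≤ ε → F l (Fin.cons t (φ s)) = 0 → ∃ i, ξ i s = t) :
    ∃ 𝒞 : Set (Set (Fin (n + 1) → ℝ)), 𝒞.Finite ∧
      (∀ C ∈ 𝒞, (∃ k' ≤ k + 1, IsAnalyticCell k' C) ∧
        (∀ y ∈ C, |y 0| ≤ ε ∧ Fin.tail y ∈ φ '' O) ∧
        ∀ l, (∀ y ∈ C, F l y = 0) ∨ ∀ y ∈ C, F l y ≠ 0) ∧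
      ∀ s ∈ O, ∀ t, |t| < ε → (Fin.cons t (φ s) : Fin (n + 1) → ℝ) ∈ ⋃₀ 𝒞 := by
  have hbd : ∀ s ∈ O, ∀ i, iₗ ≤ i → i ≤ iᵤ → |ξ i s| ≤ ε := by
    intro s hs i h1 h2
    have h1' := (hmono s hs).monotone h1
    have h2' := (hmono s hs).monotone h2
    simp only [hl s hs, hu s hs] at h1' h2'
    exact abs_le.2 ⟨h1', h2'⟩
  refine ⟨((fun i => (fun s => (Fin.cons (ξ i s) (φ s) : Fin (n + 1) → ℝ)) '' O) ''
      {i : Fin N | iₗ ≤ i ∧ i ≤ iᵤ}) ∪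
    ((fun p : Fin N × Fin N => (fun u : Fin (k + 1) → ℝ =>
      (Fin.cons (u 0) (φ (Fin.tail u)) : Fin (n + 1) → ℝ)) ''
        {u | Fin.tail u ∈ O ∧ ξ p.1 (Fin.tail u) < u 0 ∧ u 0 < ξ p.2 (Fin.tail u)}) ''
      {p : Fin N × Fin N | iₗ ≤ p.1 ∧ p.2 ≤ iᵤ ∧ (p.2 : ℕ) = p.1 + 1}),
    ((toFinite _).image _).union ((toFinite _).image _), ?_, ?_⟩
  · rintro C (⟨i, ⟨hi1, hi2⟩, rfl⟩ | ⟨⟨i, j⟩, ⟨hi, hj, hij⟩, rfl⟩)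
    · refine ⟨⟨k, by omega, isAnalyticCell_graph hO hOc hOn hφ hπ (hξ i)⟩, ?_, fun l => ?_⟩
      · rintro _ ⟨s, hs, rfl⟩
        exact ⟨by simpa using hbd s hs i hi1 hi2, by simpa using mem_image_of_mem φ hs⟩
      · simpa only [forall_mem_image] using hF l i hi1 hi2
    · simp only at hi hj hij
      have hlt : i < j := by rw [Fin.lt_def]; omega
      have hin : ∀ s ∈ O, ∀ t, ξ i s < t → t < ξ j s → |t| ≤ ε := by
        intro s hs t h1 h2
        have h3 := abs_le.1 (hbd s hs i hi (hlt.le.trans hj))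
        have h4 := abs_le.1 (hbd s hs j (hi.trans hlt.le) hj)
        exact abs_le.2 ⟨by linarith, by linarith⟩
      refine ⟨⟨k + 1, le_rfl, isAnalyticCell_band hO hOc hOn hφ hπ (hξ i) (hξ j)
        fun s hs => hmono s hs hlt⟩, ?_, fun l => Or.inr ?_⟩
      · rintro _ ⟨u, ⟨hu0, h1, h2⟩, rfl⟩
        exact ⟨by simpa using hin _ hu0 _ h1 h2, by simpa using mem_image_of_mem φ hu0⟩
      · rintro _ ⟨u, ⟨hu0, h1, h2⟩, rfl⟩ h0
        obtain ⟨m, hm⟩ := hz l _ hu0 _ (hin _ hu0 _ h1 h2) h0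
        rw [← hm] at h1 h2
        have h1' := (hmono _ hu0).lt_iff_lt.1 h1
        have h2' := (hmono _ hu0).lt_iff_lt.1 h2
        simp only [Fin.lt_def] at h1' h2'
        omega
  · intro s hs t ht
    obtain ⟨ht1, ht2⟩ := abs_lt.1 ht
    obtain ⟨i, hi, himax⟩ := (toFinite {i : Fin N | ξ i s ≤ t}).exists_maximal
      ⟨iₗ, by simp only [mem_ofPred_eq, hl s hs]; exact ht1.le⟩
    simp only [mem_ofPred_eq] at hi himax
    have hli : iₗ ≤ i := by
      by_contra! h
      exact absurd (himax (y := iₗ) (by rw [hl s hs]; exact ht1.le) h.le) (not_le.2 h)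
    have hiu : i < iᵤ := by
      rw [← (hmono s hs).lt_iff_lt]
      simp only [hu s hs]
      linarith
    rcases hi.eq_or_lt with h | h
    · exact ⟨_, Or.inl ⟨i, ⟨hli, hiu.le⟩, rfl⟩, s, hs, by simp only [h]⟩
    · have hiu' := Fin.lt_def.1 hiu
      refine ⟨_, Or.inr ⟨(i, ⟨i + 1, by omega⟩), ⟨hli, Fin.le_def.2 (by simp only; omega), rfl⟩,
        rfl⟩, Fin.cons t s, ⟨by simpa using hs, by simpa using h, ?_⟩, by simp⟩
      simp only [Fin.tail_cons, Fin.cons_zero]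
      by_contra! h'
      have := himax (y := ⟨i + 1, by omega⟩) h' (Fin.le_def.2 (by simp))
      rw [Fin.le_def] at this
      simp at this

theorem AnalyticAt.eventually_eq_zero_or_of_mul {E : Type*} [NormedAddCommGroup E]
    [NormedSpace ℝ E] {f g : E → ℝ} {x : E} (hf : AnalyticAt ℝ f x) (hg : AnalyticAt ℝ g x)
    (h : ∀ᶠ y in 𝓝 x, f y * g y = 0) : (∀ᶠ y in 𝓝 x, f y = 0) ∨ ∀ᶠ y in 𝓝 x, g y = 0 := by
  obtain ⟨r, hr, hb⟩ := Metric.eventually_nhds_iff_ball.1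
    (hf.eventually_analyticAt.and (hg.eventually_analyticAt.and h))
  by_cases h0 : ∀ y ∈ Metric.ball x r, f y = 0
  · exact Or.inl (Filter.mem_of_superset (Metric.ball_mem_nhds x hr) h0)
  · push Not at h0
    obtain ⟨y, hy, hfy⟩ := h0
    right
    have hgy : g =ᶠ[𝓝 y] 0 := by
      filter_upwards [(hb y hy).1.continuousAt.eventually_ne hfy,
        Metric.isOpen_ball.mem_nhds hy] with z hz hzb
      exact (mul_eq_zero.1 (hb z hzb).2.2).resolve_left hz
    have := AnalyticOnNhd.eqOn_zero_of_preconnected_of_eventuallyEq_zero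
      (fun z hz => (hb z hz).2.1) (convex_ball x r).isPreconnected hy hgy
    exact Filter.mem_of_superset (Metric.ball_mem_nhds x hr) this

theorem AnalyticAt.not_eventually_finset_prod_eq_zero {E : Type*} [NormedAddCommGroup E]
    [NormedSpace ℝ E] {ι : Type*} {f : ι → E → ℝ} {x : E} (s : Finset ι)
    (hf : ∀ i ∈ s, AnalyticAt ℝ (f i) x) (h : ∀ i ∈ s, ¬ ∀ᶠ y in 𝓝 x, f i y = 0) :
    ¬ ∀ᶠ y in 𝓝 x, ∏ i ∈ s, f i y = 0 := by
  classical
  induction s using Finset.induction_on with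
  | empty => simp [(nhds_neBot (x := x)).ne]
  | insert a s ha ih =>
    simp only [Finset.mem_insert, forall_eq_or_imp] at hf h
    simp only [Finset.prod_insert ha]
    intro h0
    rcases hf.1.eventually_eq_zero_or_of_mul (Finset.analyticAt_fun_prod s hf.2) h0 with h1 | h1
    · exact h.1 h1
    · exact ih hf.2 h.2 h1

theorem AnalyticAt.exists_frequently_ne_zero_smul {E : Type*} [NormedAddCommGroup E]
    [NormedSpace ℝ E] [Nontrivial E] {f : E → ℝ} (hf : AnalyticAt ℝ f 0)
    (h : ¬ ∀ᶠ y in 𝓝 0, f y = 0) : ∃ v : E, v ≠ 0 ∧ ∃ᶠ t in 𝓝 (0 : ℝ), f (t • v) ≠ 0 := by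
  have hcont : ∀ v : E, Continuous fun t : ℝ => t • v := fun v => by fun_prop
  by_cases h0 : f 0 = 0
  · obtain ⟨r, hr, hb⟩ := Metric.eventually_nhds_iff_ball.1 hf.eventually_analyticAt
    have : ∃ y ∈ Metric.ball (0 : E) r, f y ≠ 0 := by
      by_contra! hc
      exact h (Filter.mem_of_superset (Metric.ball_mem_nhds 0 hr) hc)
    obtain ⟨v, hv, hfv⟩ := this
    refine ⟨v, fun hv0 => hfv (hv0 ▸ h0), fun hfr => hfv ?_⟩
    simp only [not_not] at hfr
    have hO : IsPreconnected ((fun t : ℝ => t • v) ⁻¹' Metric.ball 0 r) :=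
      ((convex_ball (0 : E) r).linear_preimage
        (LinearMap.toSpanSingleton ℝ E v)).isPreconnected
    have han : AnalyticOnNhd ℝ (fun t : ℝ => f (t • v))
        ((fun t : ℝ => t • v) ⁻¹' Metric.ball 0 r) := fun t ht =>
      AnalyticAt.fun_comp (g := f) (f := fun t : ℝ => t • v) (hb _ ht)
        ((ContinuousLinearMap.toSpanSingleton ℝ v).analyticAt t)
    have := AnalyticOnNhd.eqOn_zero_of_preconnected_of_eventuallyEq_zero han hO
      (show (0 : ℝ) ∈ _ by simpa using hr) hfr
    simpa using this (show (1 : ℝ) ∈ _ by simpa using hv)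
  · obtain ⟨v, hv⟩ := exists_ne (0 : E)
    refine ⟨v, hv, Filter.Eventually.frequently ?_⟩
    have : ContinuousAt (fun t : ℝ => f (t • v)) 0 :=
      ContinuousAt.comp (g := f) (by simpa using hf.continuousAt) (hcont v).continuousAt
    exact this.eventually_ne (by simpa using h0)

namespace Polynomial

theorem analyticAt_coeff_finset_prod {E : Type*} [NormedAddCommGroup E] [NormedSpace ℝ E]
    {ι : Type*} {p : ι → E → ℝ[X]} {x : E} (s : Finset ι)
    (h : ∀ l ∈ s, ∀ i, AnalyticAt ℝ (fun y => (p l y).coeff i) x) (i : ℕ) :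
    AnalyticAt ℝ (fun y => (∏ l ∈ s, p l y).coeff i) x := by
  classical
  induction s using Finset.induction_on generalizing i with
  | empty => simpa using analyticAt_const
  | insert a s ha ih =>
    simp only [Finset.mem_insert, forall_eq_or_imp] at h
    simp only [Finset.prod_insert ha, coeff_mul]
    exact Finset.analyticAt_fun_sum _ fun c _ => (h.1 _).mul (ih h.2 _)

theorem card_roots_toFinset_map_le {q : ℝ[X]} :
    (q.map (algebraMap ℝ ℂ)).roots.toFinset.card ≤ q.natDegree :=
  (Multiset.toFinset_card_le _).trans ((card_roots' _).trans natDegree_map_le)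

theorem monic_X_pow_add_sum {R : Type*} [CommRing R] [Nontrivial R] {m : ℕ} (a : Fin m → R) :
    (X ^ m + ∑ j, C (a j) * X ^ (j : ℕ) : R[X]).Monic ∧
      (X ^ m + ∑ j, C (a j) * X ^ (j : ℕ) : R[X]).natDegree = m := by
  have h := degree_sum_fin_lt a
  refine ⟨monic_X_pow_add h, natDegree_eq_of_degree_eq_some ?_⟩
  rw [degree_add_eq_left_of_degree_lt (by rwa [degree_X_pow]), degree_X_pow]

end Polynomial

theorem IsAnalyticCell.exists_cover_of_polynomials {n k : ℕ} {C : Set (Fin n → ℝ)}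
    (hC : IsAnalyticCell k C) {ι : Type} [Fintype ι] {m : ι ⊕ Bool → ℕ} {M : ℕ} {ε : ℝ}
    {p : ι ⊕ Bool → (Fin n → ℝ) → Polynomial ℝ} {q : (Fin n → ℝ) → Polynomial ℝ}
    (hq : ∀ x, q x = ∏ l, p l x) (hpb : ∀ b x, p (Sum.inr b) x =
      Polynomial.X - Polynomial.C (if b then ε else -ε))
    (hmp : ∀ l x, (p l x).Monic) (hdp : ∀ l x, (p l x).natDegree = m l)
    (hcp : ∀ l i, AnalyticOnNhd ℝ (fun x => (p l x).coeff i) C)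
    (hnp : ∀ l, ∀ x ∈ C, ∀ y ∈ C, ((p l x).map (algebraMap ℝ ℂ)).roots.toFinset.card =
      ((p l y).map (algebraMap ℝ ℂ)).roots.toFinset.card)
    (hm : ∀ x, (q x).Monic) (hd : ∀ x, (q x).natDegree = M)
    (hc : ∀ i, AnalyticOnNhd ℝ (fun x => (q x).coeff i) C)
    (hn : ∀ x ∈ C, ∀ y ∈ C, ((q x).map (algebraMap ℝ ℂ)).roots.toFinset.card =
      ((q y).map (algebraMap ℝ ℂ)).roots.toFinset.card)
    {F : ι → (Fin (n + 1) → ℝ) → ℝ}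
    (hF : ∀ l, ∀ x ∈ C, ∀ t, |t| ≤ ε → (F l (Fin.cons t x) = 0 ↔ (p (Sum.inl l) x).IsRoot t)) :
    ∃ 𝒞 : Set (Set (Fin (n + 1) → ℝ)), 𝒞.Finite ∧
      (∀ D ∈ 𝒞, (∃ k' ≤ k + 1, IsAnalyticCell k' D) ∧
        (∀ y ∈ D, |y 0| ≤ ε ∧ Fin.tail y ∈ C) ∧
        ∀ l, (∀ y ∈ D, F l y = 0) ∨ ∀ y ∈ D, F l y ≠ 0) ∧
      ∀ x ∈ C, ∀ t, |t| < ε → (Fin.cons t x : Fin (n + 1) → ℝ) ∈ ⋃₀ 𝒞 := by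
  obtain ⟨O, φ, π, hO, hOc, hOn, hφ, hπ, rfl⟩ := hC
  simp only [forall_mem_image] at hnp hn hF ⊢
  obtain ⟨N, ξ, hξ, hmono, hroot, hdich⟩ := Polynomial.exists_analytic_ordered_roots_of_prod
    hO hOc hOn (p := fun l s => p l (φ s)) (q := fun s => q (φ s)) (fun s => hq _)
    (fun l s => hmp l _) (fun l s => hdp l _)
    (fun l i s hs => AnalyticAt.fun_comp (g := fun x => (p l x).coeff i)
      (hcp l i _ (mem_image_of_mem φ hs)) (hφ s hs))
    (fun l s hs s' hs' => hnp l hs hs') (fun s => hm _) (fun s => hd _)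
    (fun i s hs => AnalyticAt.fun_comp (g := fun x => (q x).coeff i)
      (hc i _ (mem_image_of_mem φ hs)) (hφ s hs))
    (fun s hs s' hs' => hn hs hs')
  have hqr : ∀ s ∈ O, ∀ l t, (p l (φ s)).IsRoot t → ∃ i, ξ i s = t := by
    intro s hs l t ht
    rw [← hroot s hs, hq, Polynomial.IsRoot, Polynomial.eval_prod]
    exact Finset.prod_eq_zero (Finset.mem_univ l) ht
  have hend : ∀ b : Bool, ∃ i, ∀ s ∈ O, ξ i s = if b then ε else -ε := by
    intro b
    obtain ⟨s₀, hs₀⟩ := hOn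
    have h0 : (p (Sum.inr b) (φ s₀)).IsRoot (if b then ε else -ε) := by simp [hpb]
    obtain ⟨i, hi⟩ := hqr s₀ hs₀ _ _ h0
    refine ⟨i, fun s hs => ?_⟩
    rcases hdich (Sum.inr b) i with h | h
    · have := h s hs
      simp only [hpb, Polynomial.root_X_sub_C] at this
      exact this.symm
    · exact absurd (hi ▸ h0) (h s₀ hs₀)
  obtain ⟨iₗ, hl⟩ := hend false
  obtain ⟨iᵤ, hu⟩ := hend true
  simp only [Bool.false_eq_true, if_false] at hl
  simp only [if_true] at hu
  have hbd : ∀ s ∈ O, ∀ i, iₗ ≤ i → i ≤ iᵤ → |ξ i s| ≤ ε := by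
    intro s hs i h1 h2
    have h1' := (hmono s hs).monotone h1
    have h2' := (hmono s hs).monotone h2
    simp only [hl s hs, hu s hs] at h1' h2'
    exact abs_le.2 ⟨h1', h2'⟩
  refine exists_cylinder_cover hO hOc hOn hφ hπ hξ hmono hl hu (fun l i h1 h2 => ?_)
    (fun l s hs t ht h0 => hqr s hs (Sum.inl l) t ((hF l hs t ht).1 h0))
  refine (hdich (Sum.inl l) i).imp (fun h s hs => ?_) (fun h s hs => ?_)
  · exact (hF l hs _ (hbd s hs i h1 h2)).2 (h s hs)
  · exact fun h0 => h s hs ((hF l hs _ (hbd s hs i h1 h2)).1 h0)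

/-- Every finite family of germs of analytic functions at the origin of `ℝ^n` admits arbitrarily
small finite covers of a neighbourhood of the origin by analytic cells on each of which every
member of the family vanishes identically or nowhere. -/
def HasLocalCellCovers (n : ℕ) : Prop :=
  ∀ (ι : Type) [Finite ι] (f : ι → (Fin n → ℝ) → ℝ), (∀ i, AnalyticAt ℝ (f i) 0) →
    ∀ W ∈ 𝓝 (0 : Fin n → ℝ), ∃ U ∈ 𝓝 (0 : Fin n → ℝ), ∃ 𝒞 : Set (Set (Fin n → ℝ)), 𝒞.Finite ∧
      (∀ C ∈ 𝒞, (∃ k ≤ n, IsAnalyticCell k C) ∧ C ⊆ W ∧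
        ∀ i, (∀ x ∈ C, f i x = 0) ∨ ∀ x ∈ C, f i x ≠ 0) ∧
      U ⊆ ⋃₀ 𝒞

theorem HasLocalCellCovers.exists_constant_card_roots {n : ℕ} (h : HasLocalCellCovers n)
    {κ : Type} [Finite κ] {d : κ → ℕ} {Q : κ → (Fin n → ℝ) → Polynomial ℝ}
    (hm : ∀ o x, (Q o x).Monic) (hd : ∀ o x, (Q o x).natDegree = d o)
    (hc : ∀ o i, AnalyticAt ℝ (fun x => (Q o x).coeff i) 0) {W : Set (Fin n → ℝ)}
    (hW : W ∈ 𝓝 0) :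
    ∃ U ∈ 𝓝 (0 : Fin n → ℝ), ∃ 𝒞 : Set (Set (Fin n → ℝ)), 𝒞.Finite ∧
      (∀ C ∈ 𝒞, (∃ k ≤ n, IsAnalyticCell k C) ∧ C ⊆ W ∧
        ∀ o, ∀ x ∈ C, ∀ y ∈ C, ((Q o x).map (algebraMap ℝ ℂ)).roots.toFinset.card =
          ((Q o y).map (algebraMap ℝ ℂ)).roots.toFinset.card) ∧
      U ⊆ ⋃₀ 𝒞 := by
  choose B hB using Polynomial.exists_generalized_discriminants
  obtain ⟨U, hU, 𝒞, hfin, h𝒞, hcov⟩ := h (Σ o, Fin (d o + 1))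
    (fun r x => MvPolynomial.aeval (fun i : Fin (d r.1) => (Q r.1 x).coeff i) (B (d r.1) r.2))
    (fun r => AnalyticAt.aeval_mvPolynomial
      (f := fun x (i : Fin (d r.1)) => (Q r.1 x).coeff i) (fun i => hc r.1 i) _) W hW
  refine ⟨U, hU, 𝒞, hfin, fun C hC => ⟨(h𝒞 C hC).1, (h𝒞 C hC).2.1, ?_⟩, hcov⟩
  have key : ∀ o, ∀ x ∈ C, ∀ y ∈ C, ¬ ((Q o x).map (algebraMap ℝ ℂ)).roots.toFinset.card <
      ((Q o y).map (algebraMap ℝ ℂ)).roots.toFinset.card := by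
    intro o x hx y hy hlt
    have hle : ((Q o y).map (algebraMap ℝ ℂ)).roots.toFinset.card < d o + 1 := by
      have := Polynomial.card_roots_toFinset_map_le (q := Q o y)
      rw [hd o y] at this
      omega
    have hx0 := (hB (d o) (Q o x) (hm o x) (hd o x)).2 _ hlt
    have hy0 := (hB (d o) (Q o y) (hm o y) (hd o y)).1
    rcases (h𝒞 C hC).2.2 ⟨o, ⟨_, hle⟩⟩ with h0 | h0
    · exact hy0 (h0 y hy)
    · exact h0 x hx hx0
  intro o x hx y hy
  exact le_antisymm (not_lt.1 (key o y hy x hx)) (not_lt.1 (key o x hx y hy))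

theorem HasLocalCellCovers.exists_cover_of_weierstrass {n : ℕ} (h : HasLocalCellCovers n)
    {ι : Type} [Finite ι] {F : ι → (Fin (n + 1) → ℝ) → ℝ} {m : ι → ℕ}
    {a : ∀ l, Fin (m l) → (Fin n → ℝ) → ℝ} (ha : ∀ l j, AnalyticAt ℝ (a l j) 0)
    (hF : ∀ l, ∀ᶠ y in 𝓝 (0 : Fin (n + 1) → ℝ),
      (F l y = 0 ↔ y 0 ^ m l + ∑ j, a l j (Fin.tail y) * y 0 ^ (j : ℕ) = 0))
    {W : Set (Fin (n + 1) → ℝ)} (hW : W ∈ 𝓝 0) :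
    ∃ U ∈ 𝓝 (0 : Fin (n + 1) → ℝ), ∃ 𝒞 : Set (Set (Fin (n + 1) → ℝ)), 𝒞.Finite ∧
      (∀ C ∈ 𝒞, (∃ k ≤ n + 1, IsAnalyticCell k C) ∧ C ⊆ W ∧
        ∀ i, (∀ x ∈ C, F i x = 0) ∨ ∀ x ∈ C, F i x ≠ 0) ∧
      U ⊆ ⋃₀ 𝒞 := by
  classical
  have := Fintype.ofFinite ι
  obtain ⟨r, hr, hb⟩ := Metric.eventually_nhds_iff_ball.1
    ((eventually_all.2 hF).and (eventually_mem_set.2 hW))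
  set ε := r / 2 with hεdef
  have hε : 0 < ε := by positivity
  have hcons : ∀ t x, |t| ≤ ε → x ∈ Metric.ball (0 : Fin n → ℝ) r →
      (Fin.cons t x : Fin (n + 1) → ℝ) ∈ Metric.ball 0 r := by
    intro t x ht hx
    rw [mem_ball_zero_iff, pi_norm_lt_iff hr] at hx ⊢
    refine Fin.cases ?_ (fun j => ?_)
    · simpa using ht.trans_lt (by linarith)
    · simpa using hx j
  have hW0 : {x : Fin n → ℝ | x ∈ Metric.ball (0 : Fin n → ℝ) r ∧
      ∀ l j, AnalyticAt ℝ (a l j) x} ∈ 𝓝 (0 : Fin n → ℝ) := by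
    filter_upwards [Metric.ball_mem_nhds (0 : Fin n → ℝ) hr,
      eventually_all.2 fun l => eventually_all.2 fun j => (ha l j).eventually_analyticAt]
      with x h1 h2 using ⟨h1, h2⟩
  let p : ι ⊕ Bool → (Fin n → ℝ) → Polynomial ℝ := Sum.elim
    (fun l x => Polynomial.X ^ m l + ∑ j, Polynomial.C (a l j x) * Polynomial.X ^ (j : ℕ))
    (fun b _ => Polynomial.X - Polynomial.C (if b then ε else -ε))
  let md : ι ⊕ Bool → ℕ := Sum.elim m fun _ => 1
  have hmp : ∀ l x, (p l x).Monic := by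
    rintro (l | b) x
    · exact (Polynomial.monic_X_pow_add_sum _).1
    · exact Polynomial.monic_X_sub_C _
  have hdp : ∀ l x, (p l x).natDegree = md l := by
    rintro (l | b) x
    · exact (Polynomial.monic_X_pow_add_sum _).2
    · exact Polynomial.natDegree_X_sub_C _
  have hcp : ∀ x, (∀ l j, AnalyticAt ℝ (a l j) x) →
      ∀ l i, AnalyticAt ℝ (fun y => (p l y).coeff i) x := by
    rintro x hx (l | b) i
    · simp only [p, Sum.elim_inl, Polynomial.coeff_add, Polynomial.finsetSum_coeff,
        Polynomial.coeff_C_mul]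
      exact analyticAt_const.add
        (Finset.analyticAt_fun_sum _ fun j _ => (hx l j).mul analyticAt_const)
    · simp only [p, Sum.elim_inr]
      exact analyticAt_const
  let Q : Option (ι ⊕ Bool) → (Fin n → ℝ) → Polynomial ℝ := fun o x =>
    o.elim (∏ l, p l x) fun l => p l x
  let dQ : Option (ι ⊕ Bool) → ℕ := fun o => o.elim (∑ l, md l) md
  have hmQ : ∀ o x, (Q o x).Monic := by
    rintro (_ | l) x
    · exact Polynomial.monic_prod_of_monic _ _ fun l _ => hmp l x
    · exact hmp l x
  have hdQ : ∀ o x, (Q o x).natDegree = dQ o := by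
    rintro (_ | l) x
    · simp only [Q, dQ, Option.elim]
      rw [Polynomial.natDegree_prod_of_monic _ _ fun l _ => hmp l x]
      exact Finset.sum_congr rfl fun l _ => hdp l x
    · exact hdp l x
  have hcQ : ∀ x, (∀ l j, AnalyticAt ℝ (a l j) x) →
      ∀ o i, AnalyticAt ℝ (fun y => (Q o y).coeff i) x := by
    rintro x hx (_ | l) i
    · exact Polynomial.analyticAt_coeff_finset_prod _ (fun l _ i => hcp x hx l i) i
    · exact hcp x hx l i
  obtain ⟨U, hU, 𝒞, hfin, h𝒞, hcov⟩ :=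
    h.exists_constant_card_roots hmQ hdQ (hcQ 0 ha) hW0
  have hcell : ∀ C ∈ 𝒞, ∃ 𝒟 : Set (Set (Fin (n + 1) → ℝ)), 𝒟.Finite ∧
      (∀ D ∈ 𝒟, (∃ k ≤ n + 1, IsAnalyticCell k D) ∧ D ⊆ W ∧
        ∀ l, (∀ y ∈ D, F l y = 0) ∨ ∀ y ∈ D, F l y ≠ 0) ∧
      ∀ x ∈ C, ∀ t, |t| < ε → (Fin.cons t x : Fin (n + 1) → ℝ) ∈ ⋃₀ 𝒟 := by
    intro C hC
    obtain ⟨⟨k, hk, hCk⟩, hCW, hcard⟩ := h𝒞 C hC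
    obtain ⟨𝒟, h1, h2, h3⟩ := hCk.exists_cover_of_polynomials (p := p) (q := Q none)
      (m := md) (F := F) (fun x => rfl) (fun b x => rfl) hmp hdp
      (fun l i x hx => hcp x (hCW hx).2 l i) (fun l => hcard (some l)) (hmQ none) (hdQ none)
      (fun i x hx => hcQ x (hCW hx).2 none i) (hcard none) (fun l x hx t ht => by
        have := (hb _ (hcons t x ht (hCW hx).1)).1 l
        simp only [Fin.cons_zero, Fin.tail_cons] at this
        rw [this]
        simp [p, Polynomial.IsRoot, Polynomial.eval_finsetSum])
    refine ⟨𝒟, h1, fun D hD => ⟨?_, fun y hy => ?_, (h2 D hD).2.2⟩, h3⟩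
    · obtain ⟨k', hk', hD'⟩ := (h2 D hD).1
      exact ⟨k', by omega, hD'⟩
    · obtain ⟨hy0, hyt⟩ := (h2 D hD).2.1 y hy
      rw [← Fin.cons_self_tail y]
      exact (hb _ (hcons _ _ hy0 (hCW hyt).1)).2
  choose! 𝒟 h𝒟fin h𝒟 h𝒟cov using hcell
  refine ⟨{y | |y 0| < ε ∧ Fin.tail y ∈ U}, ?_, ⋃ C ∈ 𝒞, 𝒟 C, hfin.biUnion h𝒟fin, ?_, ?_⟩
  · have h0 : Tendsto (fun y : Fin (n + 1) → ℝ => |y 0|) (𝓝 0) (𝓝 0) := by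
      have : Continuous fun y : Fin (n + 1) → ℝ => |y 0| := by fun_prop
      simpa using this.tendsto 0
    have ht : Tendsto (fun y : Fin (n + 1) → ℝ => (Fin.tail y : Fin n → ℝ)) (𝓝 0) (𝓝 0) := by
      have : Continuous fun y : Fin (n + 1) → ℝ => (Fin.tail y : Fin n → ℝ) :=
        continuous_pi fun i => continuous_apply _
      exact this.tendsto 0
    filter_upwards [h0.eventually_lt_const hε, ht hU] with y h1 h2 using ⟨h1, h2⟩
  · intro D hD
    obtain ⟨C, hC, hDC⟩ := mem_iUnion₂.1 hD
    exact h𝒟 C hC D hDC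
  · rintro y ⟨hy0, hyU⟩
    obtain ⟨C, hC, hyC⟩ := hcov hyU
    obtain ⟨D, hD, hyD⟩ := h𝒟cov C hC _ hyC _ hy0
    rw [Fin.cons_self_tail] at hyD
    exact ⟨D, mem_iUnion₂.2 ⟨C, hC, hD⟩, hyD⟩

theorem HasLocalCellCovers.succ {n : ℕ} (hn : HasLocalCellCovers n) :
    HasLocalCellCovers (n + 1) := by
  classical
  intro ι _ f hf W hW
  have := Fintype.ofFinite ι
  let f' : ι → (Fin (n + 1) → ℝ) → ℝ := fun i =>
    if ∀ᶠ y in 𝓝 0, f i y = 0 then fun _ => 1 else f i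
  have hf' : ∀ i, AnalyticAt ℝ (f' i) 0 := by
    intro i
    by_cases h : ∀ᶠ y in 𝓝 0, f i y = 0
    · simpa only [f', if_pos h] using analyticAt_const
    · simpa only [f', if_neg h] using hf i
  have hne : ∀ i, ¬ ∀ᶠ y in 𝓝 0, f' i y = 0 := by
    intro i
    by_cases h : ∀ᶠ y in 𝓝 0, f i y = 0
    · simp [f', if_pos h, (nhds_neBot (x := (0 : Fin (n + 1) → ℝ))).ne]
    · simpa only [f', if_neg h] using h
  obtain ⟨v, hv, hfr⟩ := AnalyticAt.exists_frequently_ne_zero_smul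
    (Finset.analyticAt_fun_prod Finset.univ fun i _ => hf' i)
    (AnalyticAt.not_eventually_finset_prod_eq_zero Finset.univ (fun i _ => hf' i)
      fun i _ => hne i)
  obtain ⟨L, hL⟩ := SeparatingDual.exists_continuousLinearEquiv_apply_eq (R := ℝ)
    (x := (Pi.single 0 1 : Fin (n + 1) → ℝ)) (y := v) (by simp) hv
  have hLc : ∀ t : ℝ, L (Fin.cons t (0 : Fin n → ℝ)) = t • v := by
    intro t
    rw [← hL, ← map_smul]
    congr 1
    ext i
    refine Fin.cases ?_ (fun j => ?_) i <;> simp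
  have hLa : ∀ y, AnalyticAt ℝ L y := fun y => L.toContinuousLinearMap.analyticAt y
  have hW' : L ⁻¹' (W ∩ {y | ∀ i, (∀ᶠ y in 𝓝 0, f i y = 0) → f i y = 0}) ∈
      𝓝 (0 : Fin (n + 1) → ℝ) := by
    refine L.continuous.continuousAt.preimage_mem_nhds ?_
    rw [map_zero]
    filter_upwards [hW, eventually_all.2 fun i => (show ∀ᶠ y in 𝓝 0,
      ((∀ᶠ y in 𝓝 0, f i y = 0) → f i y = 0) from by
        by_cases h : ∀ᶠ y in 𝓝 0, f i y = 0
        · exact h.mono fun y hy _ => hy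
        · exact Eventually.of_forall fun y hy => absurd hy h)] with y h1 h2 using ⟨h1, h2⟩
  have hwei := fun i => AnalyticAt.exists_weierstrass_polynomial (f := fun y => f' i (L y))
    (AnalyticAt.fun_comp (g := f' i) (by rw [map_zero]; exact hf' i) (hLa 0)) (by
      simp only [hLc]
      exact hfr.mono fun t ht => Finset.prod_ne_zero_iff.1 ht i (Finset.mem_univ i))
  choose m a ha hF using hwei
  obtain ⟨U, hU, 𝒞, hfin, h𝒞, hcov⟩ := hn.exists_cover_of_weierstrass ha hF hW'
  refine ⟨L '' U, ?_, (fun C => L '' C) '' 𝒞, hfin.image _, ?_, ?_⟩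
  · simpa using L.toHomeomorph.isOpenMap.image_mem_nhds hU
  · rintro _ ⟨C, hC, rfl⟩
    obtain ⟨⟨k, hk, hCk⟩, hCW, hdich⟩ := h𝒞 C hC
    refine ⟨⟨k, hk, hCk.image L⟩, image_subset_iff.2 fun y hy => (hCW hy).1, fun i => ?_⟩
    simp only [forall_mem_image]
    by_cases h : ∀ᶠ y in 𝓝 0, f i y = 0
    · exact Or.inl fun y hy => (hCW hy).2 i h
    · simpa only [f', if_neg h] using hdich i
  · rintro _ ⟨y, hy, rfl⟩
    obtain ⟨C, hC, hyC⟩ := hcov hy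
    exact ⟨L '' C, mem_image_of_mem _ hC, mem_image_of_mem L hyC⟩

theorem hasLocalCellCovers (n : ℕ) : HasLocalCellCovers n := by
  induction n with
  | zero =>
    intro ι _ f _ W hW
    refine ⟨univ, univ_mem, {univ}, finite_singleton _, ?_, by simp⟩
    rintro C rfl
    refine ⟨⟨0, le_rfl, univ, id, ContinuousLinearMap.id ℝ _, isOpen_univ, isPreconnected_univ,
      univ_nonempty, analyticOnNhd_id, fun t _ => rfl, by simp⟩, ?_, fun i => ?_⟩
    · intro x _
      rw [Subsingleton.elim x 0]
      exact mem_of_mem_nhds hW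
    · by_cases h : f i 0 = 0
      · exact Or.inl fun x _ => by rwa [Subsingleton.elim x 0]
      · exact Or.inr fun x _ => by rwa [Subsingleton.elim x 0]
  | succ n ih => exact ih.succ

namespace IsAnalyticCell

theorem add_left {E : Type*} [NormedAddCommGroup E] [NormedSpace ℝ E] {k : ℕ} {C : Set E}
    (hC : IsAnalyticCell k C) (p : E) : IsAnalyticCell k ((fun x => p + x) '' C) := by
  obtain ⟨O, φ, π, hO, hOc, hOn, hφ, hπ, rfl⟩ := hC
  have hsub : ∀ t, AnalyticAt ℝ (fun t : Fin k → ℝ => t - π p) t := fun t =>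
    analyticAt_id.sub analyticAt_const
  refine ⟨(fun t => π p + t) '' O, fun t => p + φ (t - π p), π,
    (Homeomorph.addLeft (π p)).isOpenMap O hO, hOc.image _ (by fun_prop), hOn.image _, ?_, ?_, ?_⟩
  · rintro _ ⟨t, ht, rfl⟩
    exact analyticAt_const.add (AnalyticAt.fun_comp (g := φ) (by simpa using hφ t ht) (hsub _))
  · rintro _ ⟨t, ht, rfl⟩
    simp [hπ t ht]
  · rw [image_image, image_image]
    simp

theorem nonempty {E : Type*} [NormedAddCommGroup E] [NormedSpace ℝ E] {k : ℕ} {C : Set E}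
    (hC : IsAnalyticCell k C) : C.Nonempty := by
  obtain ⟨O, φ, π, hO, hOc, hOn, hφ, hπ, rfl⟩ := hC
  exact hOn.image φ

theorem isOpen_of_full_dimension {k : ℕ} {C : Set (Fin k → ℝ)} (hC : IsAnalyticCell k C) :
    IsOpen C := by
  obtain ⟨O, φ, π, hO, hOc, hOn, hφ, hπ, rfl⟩ := hC
  have hsurj : Function.Surjective (π : (Fin k → ℝ) →ₗ[ℝ] (Fin k → ℝ)) := by
    rw [← LinearMap.range_eq_top]
    refine Submodule.eq_top_of_nonempty_interior' _ (hOn.mono (interior_maximal ?_ hO))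
    exact fun t ht => ⟨φ t, hπ t ht⟩
  have hinj := LinearMap.injective_iff_surjective.2 hsurj
  suffices φ '' O = π ⁻¹' O by
    rw [this]
    exact hO.preimage π.continuous
  ext y
  constructor
  · rintro ⟨t, ht, rfl⟩
    simpa only [mem_preimage, hπ t ht] using ht
  · exact fun hy => ⟨π y, hy, hinj (hπ _ hy)⟩

end IsAnalyticCell

theorem AnalyticOnNhd.dimH_image_le {E F : Type*} [NormedAddCommGroup E] [NormedSpace ℝ E]
    [SecondCountableTopology E] [NormedAddCommGroup F] [NormedSpace ℝ F] [CompleteSpace F]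
    {φ : E → F} {O s : Set E}
    (hφ : AnalyticOnNhd ℝ φ O) (hs : s ⊆ O) : dimH (φ '' s) ≤ dimH s := by
  refine dimH_image_le_of_locally_lipschitzOn fun x hx => ?_
  obtain ⟨K, t, ht, hK⟩ := ((hφ x (hs hx)).contDiffAt (n := 1)).exists_lipschitzOnWith
  exact ⟨K, t, mem_nhdsWithin_of_mem_nhds ht, hK⟩

theorem IsAnalyticCell.dimH_le {E : Type*} [NormedAddCommGroup E] [NormedSpace ℝ E]
    [CompleteSpace E] {k : ℕ} {C : Set E} (hC : IsAnalyticCell k C) : dimH C ≤ k := by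
  obtain ⟨O, φ, π, hO, hOc, hOn, hφ, hπ, rfl⟩ := hC
  calc dimH (φ '' O) ≤ dimH O := hφ.dimH_image_le subset_rfl
    _ ≤ dimH (univ : Set (Fin k → ℝ)) := dimH_mono (subset_univ _)
    _ = k := Real.dimH_univ_pi_fin k

theorem IsAnalyticCell.le_dimH_inter {E : Type*} [NormedAddCommGroup E] [NormedSpace ℝ E] {k : ℕ}
    {C V : Set E} (hC : IsAnalyticCell k C) (hV : IsOpen V) (hCV : (C ∩ V).Nonempty) :
    (k : ENNReal) ≤ dimH (C ∩ V) := by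
  obtain ⟨O, φ, π, hO, hOc, hOn, hφ, hπ, rfl⟩ := hC
  have hopen : IsOpen (O ∩ φ ⁻¹' V) := hφ.continuousOn.isOpen_inter_preimage hO hV
  have hne : (O ∩ φ ⁻¹' V).Nonempty := by
    obtain ⟨_, ⟨t, ht, rfl⟩, htV⟩ := hCV
    exact ⟨t, ht, htV⟩
  have hdim : dimH (O ∩ φ ⁻¹' V) = k := by
    rw [Real.dimH_of_nonempty_interior (by rwa [hopen.interior_eq]), Module.finrank_fin_fun]
  calc (k : ENNReal) = dimH (O ∩ φ ⁻¹' V) := hdim.symm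
    _ ≤ dimH (π '' (φ '' O ∩ V)) := dimH_mono fun t ht =>
        ⟨φ t, ⟨mem_image_of_mem φ ht.1, ht.2⟩, hπ t ht.1⟩
    _ ≤ dimH (φ '' O ∩ V) := π.lipschitz.dimH_image_le _

theorem AnalyticAt.exists_cell_cover {E : Type*} [NormedAddCommGroup E] [NormedSpace ℝ E] {n : ℕ}
    (L : (Fin n → ℝ) ≃L[ℝ] E) {f : E → ℝ} {p : E} (hf : AnalyticAt ℝ f p) {W : Set E}
    (hW : W ∈ 𝓝 p) :
    ∃ U ∈ 𝓝 p, ∃ 𝒞 : Set (Set E), 𝒞.Finite ∧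
      (∀ C ∈ 𝒞, (∃ k ≤ n, IsAnalyticCell k C) ∧ C ⊆ W ∧
        ((∀ x ∈ C, f x = 0) ∨ ∀ x ∈ C, f x ≠ 0)) ∧ U ⊆ ⋃₀ 𝒞 := by
  have hcont : Continuous fun y => p + L y := by fun_prop
  have han : AnalyticAt ℝ (fun y => p + L y) 0 :=
    analyticAt_const.add (L.toContinuousLinearMap.analyticAt 0)
  obtain ⟨U, hU, 𝒞, hfin, h𝒞, hcov⟩ := hasLocalCellCovers n Unit (fun _ y => f (p + L y))
    (fun _ => AnalyticAt.fun_comp (g := f) (by simpa using hf) han) ((fun y => p + L y) ⁻¹' W)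
    (hcont.continuousAt.preimage_mem_nhds (by simpa using hW))
  refine ⟨(fun y => p + L y) '' U, ?_, (fun C => (fun y => p + L y) '' C) '' 𝒞, hfin.image _,
    ?_, ?_⟩
  · have := (L.toHomeomorph.trans (Homeomorph.addLeft p)).isOpenMap.image_mem_nhds hU
    rw [show (L.toHomeomorph.trans (Homeomorph.addLeft p)) 0 = p by simp] at this
    exact this
  · rintro _ ⟨C, hC, rfl⟩
    obtain ⟨⟨k, hk, hCk⟩, hCW, hdich⟩ := h𝒞 C hC
    refine ⟨⟨k, hk, ?_⟩, image_subset_iff.2 hCW, ?_⟩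
    · simpa only [image_image] using (hCk.image L).add_left p
    · simpa only [forall_mem_image] using hdich ()
  · rintro _ ⟨y, hy, rfl⟩
    obtain ⟨C, hC, hyC⟩ := hcov hy
    exact ⟨_, mem_image_of_mem _ hC, mem_image_of_mem _ hyC⟩

theorem AnalyticOnNhd.dimH_zeros_lt {k : ℕ} {O : Set (Fin k → ℝ)} {f : (Fin k → ℝ) → ℝ}
    (hf : AnalyticOnNhd ℝ f O) (hO : IsOpen O) (hOc : IsPreconnected O)
    (hne : ∃ x ∈ O, f x ≠ 0) (hz : ∃ x ∈ O, f x = 0) : dimH (O ∩ {x | f x = 0}) < k := by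
  obtain ⟨x₀, hx₀, hfx₀⟩ := hne
  obtain ⟨x₁, hx₁, hfx₁⟩ := hz
  rcases k with _ | k
  · exact absurd (Subsingleton.elim x₁ x₀ ▸ hfx₁) hfx₀
  suffices dimH (O ∩ {x | f x = 0}) ≤ k from this.trans_lt (by exact_mod_cast k.lt_succ_self)
  by_contra! hlt
  obtain ⟨x, ⟨hxO, -⟩, hx⟩ := exists_mem_nhdsWithin_lt_dimH_of_lt_dimH hlt
  obtain ⟨U, hU, 𝒞, hfin, h𝒞, hcov⟩ := (hf x hxO).exists_cell_cover
    (ContinuousLinearEquiv.refl ℝ _) (hO.mem_nhds hxO)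
  refine (hx _ (inter_mem_nhdsWithin _ hU)).not_ge ?_
  calc dimH (O ∩ {x | f x = 0} ∩ U) ≤ dimH (⋃ C ∈ {C ∈ 𝒞 | ∀ x ∈ C, f x = 0}, C) := by
        refine dimH_mono fun y hy => ?_
        obtain ⟨C, hC, hyC⟩ := hcov hy.2
        exact mem_iUnion₂.2
          ⟨C, ⟨hC, (h𝒞 C hC).2.2.resolve_right fun h => h y hyC hy.1.2⟩, hyC⟩
    _ ≤ k := by
        rw [dimH_bUnion (hfin.subset (sep_subset _ _)).countable]
        refine iSup₂_le fun C hC => ?_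
        obtain ⟨⟨k', hk', hCk⟩, hCO, -⟩ := h𝒞 C hC.1
        rcases hk'.eq_or_lt with rfl | hlt'
        · obtain ⟨y, hy⟩ := hCk.nonempty
          exact absurd (hf.eqOn_zero_of_preconnected_of_eventuallyEq_zero hOc (hCO hy)
            (Filter.mem_of_superset (hCk.isOpen_of_full_dimension.mem_nhds hy) hC.2) hx₀) hfx₀
        · exact hCk.dimH_le.trans (by exact_mod_cast Nat.lt_succ_iff.1 hlt')

theorem IsAnalyticCell.dimH_zeros_lt {E : Type*} [NormedAddCommGroup E] [NormedSpace ℝ E]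
    [CompleteSpace E] {k : ℕ} {C : Set E} (hC : IsAnalyticCell k C) {f : E → ℝ} (hf : AnalyticOnNhd ℝ f C)
    (hne : ∃ x ∈ C, f x ≠ 0) (hz : ∃ x ∈ C, f x = 0) : dimH (C ∩ {x | f x = 0}) < k := by
  obtain ⟨O, φ, π, hO, hOc, hOn, hφ, hπ, rfl⟩ := hC
  rw [exists_mem_image] at hne hz
  have hfφ : AnalyticOnNhd ℝ (fun t => f (φ t)) O := fun t ht =>
    AnalyticAt.fun_comp (g := f) (hf _ (mem_image_of_mem φ ht)) (hφ t ht)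
  calc dimH (φ '' O ∩ {x | f x = 0}) ≤ dimH (φ '' (O ∩ {t | f (φ t) = 0})) := by
        refine dimH_mono ?_
        rintro _ ⟨⟨t, ht, rfl⟩, h0⟩
        exact ⟨t, ⟨ht, h0⟩, rfl⟩
    _ ≤ dimH (O ∩ {t | f (φ t) = 0}) := hφ.dimH_image_le inter_subset_left
    _ < k := hfφ.dimH_zeros_lt hO hOc hne hz

theorem AnalyticAt.complex_normSq {E : Type*} [NormedAddCommGroup E] [NormedSpace ℝ E]
    {f : E → ℂ} {x : E} (hf : AnalyticAt ℝ f x) :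
    AnalyticAt ℝ (fun y => Complex.normSq (f y)) x := by
  simp only [Complex.normSq_apply]
  have hre : AnalyticAt ℝ (fun y => (f y).re) x := (Complex.reCLM.analyticAt _).fun_comp hf
  have him : AnalyticAt ℝ (fun y => (f y).im) x := (Complex.imCLM.analyticAt _).fun_comp hf
  exact (hre.mul hre).add (him.mul him)

theorem AnalyticOnNhd.exists_cell_cover_of_isCompact {E : Type*} [NormedAddCommGroup E]
    [NormedSpace ℝ E] {n : ℕ} (L : (Fin n → ℝ) ≃L[ℝ] E) {f : E → ℝ} {Ω K : Set E}
    (hf : AnalyticOnNhd ℝ f Ω) (hΩ : IsOpen Ω) (hK : IsCompact K) (hKΩ : K ⊆ Ω) :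
    ∃ 𝒞 : Set (Set E), 𝒞.Finite ∧ (∀ C ∈ 𝒞, (∃ k, IsAnalyticCell k C) ∧ C ⊆ Ω ∧
      ((∀ x ∈ C, f x = 0) ∨ ∀ x ∈ C, f x ≠ 0)) ∧ K ⊆ ⋃₀ 𝒞 := by
  refine hK.induction_on (p := fun K => ∃ 𝒞 : Set (Set E), 𝒞.Finite ∧
    (∀ C ∈ 𝒞, (∃ k, IsAnalyticCell k C) ∧ C ⊆ Ω ∧
      ((∀ x ∈ C, f x = 0) ∨ ∀ x ∈ C, f x ≠ 0)) ∧ K ⊆ ⋃₀ 𝒞) ⟨∅, by simp⟩ ?_ ?_ ?_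
  · rintro s t hst ⟨𝒞, h1, h2, h3⟩
    exact ⟨𝒞, h1, h2, hst.trans h3⟩
  · rintro s t ⟨𝒞, h1, h2, h3⟩ ⟨𝒟, h4, h5, h6⟩
    refine ⟨𝒞 ∪ 𝒟, h1.union h4, fun C hC => hC.elim (h2 C) (h5 C), ?_⟩
    rw [sUnion_union]
    exact union_subset_union h3 h6
  · intro p hp
    obtain ⟨U, hU, 𝒞, h1, h2, h3⟩ :=
      (hf p (hKΩ hp)).exists_cell_cover L (hΩ.mem_nhds (hKΩ hp))
    refine ⟨U, mem_nhdsWithin_of_mem_nhds hU, 𝒞, h1, fun C hC => ?_, h3⟩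
    obtain ⟨⟨k, -, hk⟩, h⟩ := h2 C hC
    exact ⟨⟨k, hk⟩, h⟩

theorem DifferentiableOn.finite_zeros_inter_isCompact {u : ℂ → ℂ} {D K : Set ℂ}
    (hu : DifferentiableOn ℂ u D) (hD : IsOpen D) (hDc : IsPreconnected D) {z₀ : ℂ}
    (hz₀ : z₀ ∈ D) (hne : u z₀ ≠ 0) (hK : IsCompact K) (hKD : K ⊆ D) :
    {z ∈ K | u z = 0}.Finite := by
  by_contra hinf
  obtain ⟨z, hz, hacc⟩ := Set.Infinite.exists_accPt_of_subset_isCompact hinf hK (sep_subset _ _)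
  have hfr : ∃ᶠ w in 𝓝[≠] z, u w = 0 :=
    (accPt_iff_frequently_nhdsNE.1 hacc).mono fun w hw => hw.2
  exact hne ((hu.analyticOnNhd hD).eqOn_zero_of_preconnected_of_frequently_eq_zero hDc (hKD hz)
    hfr hz₀)

/-- Lemma 2.4 of the paper, with dimension rendered as Hausdorff dimension. Let `X` be an
analytic variety in `Ω` (the common zero set of finitely many real-analytic functions)
meeting the compactly contained subdomain `Ω''`. Under the analyticity/holomorphy
assumptions on `θ` and the nonvanishing of `θ_0` on `Ω`, the set of frequencies `ω` in the
compact set `𝒜 ⊆ D` for which `Z(ω) ∩ X ∩ Ω''` is nonempty with the same Hausdorff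
dimension as `X ∩ Ω''` is finite, where `Z(ω) = {x ∈ Ω : θ_ω(x) = 0}`. -/
theorem stmt_8 (d : ℕ) (hd : 1 ≤ d)
    (Ω Ω'' : Set (EuclideanSpace ℝ (Fin d)))
    (hΩ : IsOpen Ω) (hΩ'' : IsOpen Ω'')
    (hΩ''cpt : IsCompact (closure Ω'')) (hΩ''sub : closure Ω'' ⊆ Ω)
    (D : Set ℂ) (hD : IsOpen D) (hDconn : IsPreconnected D) (h0D : (0 : ℂ) ∈ D)
    (𝒜 : Set ℂ) (h𝒜D : 𝒜 ⊆ D) (h𝒜cpt : IsCompact 𝒜)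
    (θ : ℂ → EuclideanSpace ℝ (Fin d) → ℂ)
    (hAnal : ∀ ω ∈ D, AnalyticOnNhd ℝ (θ ω) Ω)
    (hHol : ∀ x ∈ Ω, DifferentiableOn ℂ (fun ω => θ ω x) D)
    (hθ0 : ∀ x ∈ Ω, θ 0 x ≠ 0)
    (N : ℕ) (g : Fin N → EuclideanSpace ℝ (Fin d) → ℂ)
    (hg : ∀ j, AnalyticOnNhd ℝ (g j) Ω)
    (X : Set (EuclideanSpace ℝ (Fin d)))
    (hX : X = {x ∈ Ω | ∀ j, g j x = 0})
    (hXne : (X ∩ Ω'').Nonempty)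
    (Z : ℂ → Set (EuclideanSpace ℝ (Fin d)))
    (hZ : ∀ ω, Z ω = {x ∈ Ω | θ ω x = 0}) :
    {ω ∈ 𝒜 | (Z ω ∩ X ∩ Ω'').Nonempty ∧
      dimH (Z ω ∩ X ∩ Ω'') = dimH (X ∩ Ω'')}.Finite := by
  have hXG : X = {x ∈ Ω | ∑ j, Complex.normSq (g j x) = 0} := by
    rw [hX]
    ext x
    simp only [mem_ofPred_eq, Finset.sum_eq_zero_iff_of_nonneg
      fun j _ => Complex.normSq_nonneg _, Finset.mem_univ, true_imp_iff, Complex.normSq_eq_zero]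
  have hGan : AnalyticOnNhd ℝ (fun x => ∑ j, Complex.normSq (g j x)) Ω := fun x hx =>
    Finset.analyticAt_fun_sum _ fun j _ => (hg j x hx).complex_normSq
  obtain ⟨𝒞, hfin, h𝒞, hcov⟩ := hGan.exists_cell_cover_of_isCompact
    (EuclideanSpace.equiv (Fin d) ℝ).symm hΩ hΩ''cpt hΩ''sub
  have hcell : ∀ C ∈ {C ∈ 𝒞 | C ⊆ X}, {ω ∈ 𝒜 | ∀ x ∈ C, θ ω x = 0}.Finite := by
    rintro C ⟨hC, -⟩
    obtain ⟨⟨k, hCk⟩, hCΩ, -⟩ := h𝒞 C hC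
    obtain ⟨x, hx⟩ := hCk.nonempty
    exact ((hHol x (hCΩ hx)).finite_zeros_inter_isCompact hD hDconn h0D (hθ0 x (hCΩ hx)) h𝒜cpt
      h𝒜D).subset fun ω hω => ⟨hω.1, hω.2 x hx⟩
  refine ((hfin.subset (sep_subset _ _)).biUnion hcell).subset ?_
  rintro ω ⟨hω, hne, hdim⟩
  rw [mem_iUnion₂]
  by_contra! hcon
  have hcover : ∀ y ∈ Z ω ∩ X ∩ Ω'', ∃ C ∈ {C ∈ 𝒞 | C ⊆ X}, y ∈ C ∧ θ ω y = 0 := by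
    rintro y ⟨⟨hyZ, hyX⟩, hyΩ⟩
    obtain ⟨C, hC, hyC⟩ := hcov (subset_closure hyΩ)
    rw [hXG] at hyX
    rw [hZ] at hyZ
    refine ⟨C, ⟨hC, fun x hx => ?_⟩, hyC, hyZ.2⟩
    rw [hXG]
    exact ⟨(h𝒞 C hC).2.1 hx, (h𝒞 C hC).2.2.resolve_right (fun h => h y hyC hyX.2) x hx⟩
  have hfin₂ : {C ∈ {C ∈ 𝒞 | C ⊆ X} | (C ∩ {x | θ ω x = 0} ∩ Ω'').Nonempty}.Finite :=
    hfin.subset fun C hC => hC.1.1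
  obtain ⟨C, ⟨⟨hC, hCX⟩, y, ⟨hyC, hy0⟩, hyΩ⟩, hmax⟩ := Set.exists_max_image
    {C ∈ {C ∈ 𝒞 | C ⊆ X} | (C ∩ {x | θ ω x = 0} ∩ Ω'').Nonempty}
    (fun C => dimH (C ∩ {x | θ ω x = 0})) hfin₂ (by
      obtain ⟨y, hy⟩ := hne
      obtain ⟨C, hC, hyC, hy0⟩ := hcover y hy
      exact ⟨C, hC, y, ⟨hyC, hy0⟩, hy.2⟩)
  obtain ⟨⟨k, hCk⟩, hCΩ, -⟩ := h𝒞 C hC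
  have hlt : dimH (C ∩ {x | θ ω x = 0}) < k := by
    have := hCk.dimH_zeros_lt (f := fun x => Complex.normSq (θ ω x))
      (fun x hx => (hAnal ω (h𝒜D hω) x (hCΩ hx)).complex_normSq) (by
        by_contra! h
        exact hcon C ⟨hC, hCX⟩ ⟨hω, fun x hx => Complex.normSq_eq_zero.1 (h x hx)⟩)
      ⟨y, hyC, Complex.normSq_eq_zero.2 hy0⟩
    simpa only [Complex.normSq_eq_zero] using this
  refine hdim.not_lt ?_
  calc dimH (Z ω ∩ X ∩ Ω'')
      ≤ dimH (⋃ C ∈ {C ∈ {C ∈ 𝒞 | C ⊆ X} | (C ∩ {x | θ ω x = 0} ∩ Ω'').Nonempty},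
          C ∩ {x | θ ω x = 0}) := by
        refine dimH_mono fun y hy => ?_
        obtain ⟨C, hC, hyC, hy0⟩ := hcover y hy
        exact mem_iUnion₂.2 ⟨C, ⟨hC, y, ⟨hyC, hy0⟩, hy.2⟩, hyC, hy0⟩
    _ ≤ dimH (C ∩ {x | θ ω x = 0}) := by
        rw [dimH_bUnion hfin₂.countable]
        exact iSup₂_le hmax
    _ < k := hlt
    _ ≤ dimH (C ∩ Ω'') := hCk.le_dimH_inter hΩ'' ⟨y, hyC, hyΩ⟩
    _ ≤ dimH (X ∩ Ω'') := dimH_mono (inter_subset_inter_left _ hCX)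
end
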